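/- arXiv:1410.3378 — 2 statements merged into one kernel-verified Lean document; each statement's English description precedes it below -/
import Mathlib

section
/- Let K be a number field with ring of integers 𝓞_K, let f ∈ 𝓞_K[x] with deg f = d ≥ 2, and for each n ≥ 1 let K_n be a splitting field of f^{∘n}(x) − t over K(t) and G_n = Gal(K_n/K(t)), acting on the roots of f^{∘n}(x) − t. Assume K is algebraically closed in K_n for every n ≥ 1, and that FPP(G_n) → 0 as n → ∞. Then for every ε > 0 there exists M such that every nonzero prime ideal 𝔭 of 𝓞_K with N(𝔭) > M and with the leading coefficient of f not in 𝔭 satisfies #Per(f_𝔭) + 1 ≤ ε·(N(𝔭) + 1); that is, the proportion of periodic points of f_𝔭 on the projective line over κ(𝔭) tends to 0 as N(𝔭) → ∞. -/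
open NumberField Polynomial

/-- The number of periodic points of the self-map of `R ⧸ I` induced by a polynomial
`f ∈ R[x]` (reduce the coefficients of `f` modulo `I` and iterate evaluation). -/
noncomputable def perCount {R : Type*} [CommRing R] (f : Polynomial R) (I : Ideal R) : ℕ :=
  Set.ncard {z : R ⧸ I | ∃ m : ℕ, 0 < m ∧
    (fun w => (f.map (Ideal.Quotient.mk I)).eval w)^[m] z = z}

/-- `FPP h` is the proportion of elements of the Galois group of (a splitting field of)
`h` that fix at least one root of `h`. -/
noncomputable def FPP {F : Type*} [Field F] (h : Polynomial F) : ℝ :=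
  (Nat.card {σ : h.Gal // ∃ x : h.SplittingField, Polynomial.aeval x h = 0 ∧ σ x = x} : ℝ) /
    (Nat.card h.Gal : ℝ)

/-- `iterMinusT K f n` is the polynomial `f^{∘n}(x) − t` over `K(t)`, for
`f ∈ 𝓞_K[x]`. -/
noncomputable def iterMinusT (K : Type*) [Field K] [NumberField K]
    (f : Polynomial (𝓞 K)) (n : ℕ) : Polynomial (RatFunc K) :=
  ((fun g => f.comp g)^[n] Polynomial.X).map
      ((algebraMap K (RatFunc K)).comp (algebraMap (𝓞 K) K)) -
    Polynomial.C RatFunc.X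

/-- The embedding of the constant field `K` into a splitting field of a polynomial
over `K(t)`. -/
noncomputable def constEmb (K : Type*) [Field K] [NumberField K]
    (h : Polynomial (RatFunc K)) : K →+* h.SplittingField :=
  (algebraMap (RatFunc K) h.SplittingField).comp (algebraMap K (RatFunc K))

section part1

theorem pp_iter_pow {R B : Type*} [CommRing R] [CommRing B] [Algebra R B] (D : Derivation R B B) (s b : B) (n : ℕ) :
    ∀ k ≤ n, ∃ c, D^[k] (s * b ^ n) =
      (n.descFactorial k : B) * s * b ^ (n - k) * (D b) ^ k + b ^ (n - k + 1) * c := by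
  intro k
  induction k with
  | zero => intro _; exact ⟨0, by simp⟩
  | succ k ih =>
    intro hk
    obtain ⟨c, hc⟩ := ih (by omega)
    rw [Function.iterate_succ_apply', hc]
    obtain ⟨m, rfl⟩ : ∃ m, n = m + 1 + k := ⟨n - k - 1, by omega⟩
    have e1 : m + 1 + k - k = m + 1 := by omega
    have e2 : m + 1 + k - (k + 1) = m := by omega
    rw [e1, e2, Nat.descFactorial_succ, e1]
    refine ⟨((m + 1 + k).descFactorial k : B) * D (s * (D b) ^ k) + (m + 2) * D b * c + b * D c, ?_⟩
    have : ((m + 1 + k).descFactorial k : B) * s * b ^ (m + 1) * (D b) ^ k =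
      ((m + 1 + k).descFactorial k) • ((s * (D b) ^ k) * b ^ (m + 1)) := by
      simp only [nsmul_eq_mul]; ring
    rw [this, map_add, map_nsmul, D.leibniz, D.leibniz (b ^ _), D.leibniz_pow, D.leibniz_pow]
    simp only [nsmul_eq_mul, smul_eq_mul, Nat.add_sub_cancel]
    push_cast
    ring

theorem pp_stable {R A B G : Type*} [CommRing R] [CommRing A] [CommRing B] [Algebra R B] [Algebra A B] [Group G] [Finite G]
    [MulSemiringAction G B] [Algebra.IsInvariant A B G] (D : Derivation R B B)
    (P : Ideal B) [P.IsPrime]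
    (hI : ∀ x ∈ (P.under A).map (algebraMap A B), D x ∈ (P.under A).map (algebraMap A B))
    (hG : (((Nat.card G).factorial : ℕ) : B) ∉ P) (b : B) (hb : b ∈ P) : D b ∈ P := by
  classical
  have : Fintype G := Fintype.ofFinite G
  obtain ⟨C, hCm, hCd, hC⟩ : ∃ C : A[X], C.Monic ∧ C.natDegree ≤ Nat.card G ∧ aeval b C = 0 := by
    obtain ⟨C, hC1, hC2, hC3⟩ := Polynomial.lifts_and_natDegree_eq_and_monic
      (Algebra.IsInvariant.charpoly_mem_lifts A B G b) (MulSemiringAction.monic_charpoly G b)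
    refine ⟨C, hC3, ?_, ?_⟩
    · rw [hC2, MulSemiringAction.charpoly_eq]
      refine (natDegree_prod_le _ _).trans ?_
      have h1 : ∀ g ∈ (Finset.univ : Finset G), (X - Polynomial.C (g • b) : B[X]).natDegree ≤ 1 :=
        fun g _ => natDegree_X_sub_C_le _
      have h2 := Finset.sum_le_card_nsmul _ _ 1 h1
      rw [Nat.card_eq_fintype_card]
      simpa using h2
    · rw [aeval_def, eval₂_eq_eval_map, hC1]
      exact MulSemiringAction.eval_charpoly G b
  set I := (P.under A).map (algebraMap A B) with hIdef
  have hIP : I ≤ P := Ideal.map_comap_le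
  have hex : ∃ n, C.coeff n ∉ P.under A := by
    refine ⟨C.natDegree, ?_⟩
    rw [hCm.coeff_natDegree]
    exact (Ideal.ne_top_iff_one _).mp (Ideal.IsPrime.ne_top inferInstance)
  set n := Nat.find hex with hn
  have hn1 : C.coeff n ∉ P.under A := Nat.find_spec hex
  have hn2 : ∀ i < n, C.coeff i ∈ P.under A := fun i hi => by
    simpa using Nat.find_min hex hi
  have hnN : n ≤ C.natDegree := by
    by_contra h
    exact hn1 (by rw [coeff_eq_zero_of_natDegree_lt (by omega)]; exact zero_mem _)
  set s : B := ∑ i ∈ Finset.range (C.natDegree - n + 1), algebraMap A B (C.coeff (n + i)) * b ^ i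
  have hs : s ∉ P := by
    intro h
    have : s - algebraMap A B (C.coeff n) ∈ P := by
      simp only [s, Finset.sum_range_succ']
      simp only [pow_zero, mul_one, add_zero, add_sub_cancel_right]
      exact Ideal.sum_mem _ fun i _ => Ideal.mul_mem_left _ _ (by
        rw [pow_succ]; exact Ideal.mul_mem_left _ _ hb)
    exact hn1 (by simpa using (P.sub_mem h this))
  have hsb : s * b ^ n ∈ I := by
    have h0 : ∑ i ∈ Finset.range (n + (C.natDegree - n + 1)), algebraMap A B (C.coeff i) * b ^ i = 0 := by
      rw [← hC, aeval_eq_sum_range]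
      simp only [Algebra.smul_def]
      congr 2; omega
    rw [Finset.sum_range_add] at h0
    have : s * b ^ n = - ∑ i ∈ Finset.range n, algebraMap A B (C.coeff i) * b ^ i := by
      rw [eq_neg_iff_add_eq_zero, ← h0, add_comm, Finset.sum_mul]
      congr 1
      exact Finset.sum_congr rfl fun i _ => by rw [pow_add]; ring
    rw [this]
    exact I.neg_mem (I.sum_mem fun i hi => I.mul_mem_right _
      (Ideal.mem_map_of_mem _ (hn2 i (Finset.mem_range.mp hi))))
  have hk : ∀ k, D^[k] (s * b ^ n) ∈ I := by
    intro k
    induction k with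
    | zero => exact hsb
    | succ k ih => rw [Function.iterate_succ_apply']; exact hI _ ih
  obtain ⟨c, hc⟩ := pp_iter_pow D s b n n le_rfl
  have h1 := hIP (hk n)
  rw [hc] at h1
  simp only [Nat.descFactorial_self, Nat.sub_self, pow_zero, mul_one, zero_add, pow_one] at h1
  have h2 : (n.factorial : B) * s * D b ^ n ∈ P := by
    simpa using P.sub_mem h1 (P.mul_mem_right c hb)
  rcases Ideal.IsPrime.mem_or_mem inferInstance h2 with h | h
  · rcases Ideal.IsPrime.mem_or_mem inferInstance h with h | h
    · refine absurd ?_ hG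
      obtain ⟨m, hm⟩ := Nat.factorial_dvd_factorial (hnN.trans hCd)
      rw [hm]; push_cast; exact P.mul_mem_right _ h
    · exact absurd h hs
  · exact Ideal.IsPrime.mem_of_pow_mem inferInstance _ h

theorem pp_ord_mul {R B : Type*} [CommRing R] [CommRing B] [Algebra R B] (D : Derivation R B B) (Q : Ideal B) :
    ∀ (m n : ℕ) (x y : B), (∀ k < m, D^[k] x ∈ Q) → (∀ k < n, D^[k] y ∈ Q) →
      ∀ k < m + n, D^[k] (x * y) ∈ Q := by
  suffices H : ∀ k m n : ℕ, ∀ (x y : B), (∀ k < m, D^[k] x ∈ Q) → (∀ k < n, D^[k] y ∈ Q) →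
      k < m + n → D^[k] (x * y) ∈ Q from fun m n x y hx hy k hk => H k m n x y hx hy hk
  intro k
  induction k with
  | zero =>
    intro m n x y hx hy hk
    rcases Nat.eq_zero_or_pos m with h | h
    · exact Q.mul_mem_left _ (hy 0 (by omega))
    · exact Q.mul_mem_right _ (hx 0 h)
  | succ k ih =>
    intro m n x y hx hy hk
    rw [Function.iterate_succ_apply, D.leibniz, smul_eq_mul, smul_eq_mul]
    rw [iterate_map_add]
    refine Q.add_mem ?_ ?_
    · exact ih m (n - 1) x (D y) hx (fun j hj => by
        rw [← Function.iterate_succ_apply]; exact hy _ (by omega)) (by omega)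
    · exact ih n (m - 1) y (D x) hy (fun j hj => by
        rw [← Function.iterate_succ_apply]; exact hx _ (by omega)) (by omega)

theorem pp_ord_prod {R B ι : Type*} [CommRing R] [CommRing B] [Algebra R B] (D : Derivation R B B) (Q : Ideal B)
    (S : Finset ι) (m : ι → ℕ) (x : ι → B) (h : ∀ i ∈ S, ∀ k < m i, D^[k] (x i) ∈ Q) :
      ∀ k < ∑ i ∈ S, m i, D^[k] (∏ i ∈ S, x i) ∈ Q := by
  classical
  induction S using Finset.induction_on with
  | empty => simp
  | insert a S ha ih =>
    rw [Finset.sum_insert ha, Finset.prod_insert ha]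
    exact pp_ord_mul D Q _ _ _ _ (h a (by simp)) (ih fun i hi => h i (by simp [hi]))

theorem pp_mult {κ : Type*} [Field κ] (δ N : κ[X]) (a : κ) (r : ℕ) (hδ : δ.eval a ≠ 0)
    (hr : ((r.factorial : ℕ) : κ) ≠ 0) (hN : N ≠ 0)
    (h : ∀ k < r, (((fun g => δ * derivative g)^[k] N).eval a) = 0) :
    r ≤ N.rootMultiplicity a := by
  by_contra hlt
  push Not at hlt
  set j := N.rootMultiplicity a with hj
  let D : Derivation κ κ[X] κ[X] := δ • (Polynomial.derivative' (R := κ))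
  have hD : (D : κ[X] → κ[X]) = fun g => δ * derivative g := by
    ext1 g; rfl
  obtain ⟨u, hu, hu2⟩ := Polynomial.exists_eq_pow_rootMultiplicity_mul_and_not_dvd N hN a
  obtain ⟨c, hc⟩ := pp_iter_pow D u (X - C a) j j le_rfl
  have h1 := h j hlt
  rw [← hD, hu, mul_comm, ← hj, hc] at h1
  have hDX : D (X - C a) = δ := by rw [hD]; simp
  rw [hDX] at h1
  simp only [Nat.descFactorial_self, Nat.sub_self, pow_zero, mul_one, zero_add, pow_one, eval_add,
    eval_mul, eval_natCast, eval_sub, eval_X, eval_C, sub_self, zero_mul, add_zero, eval_pow] at h1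
  rw [mul_eq_zero, mul_eq_zero] at h1
  rcases h1 with (h1 | h1) | h1
  · apply hr
    obtain ⟨m, hm⟩ := Nat.factorial_dvd_factorial hlt.le
    rw [hm]; push_cast; rw [h1, zero_mul]
  · exact hu2 (dvd_iff_isRoot.mpr h1)
  · exact hδ (pow_eq_zero_iff (by rintro h; rw [h] at h1; simp at h1) |>.mp h1)

end part1

section part2

theorem pp_iter_sum {R B ι : Type*} [CommRing R] [CommRing B] [Algebra R B] (D : Derivation R B B)
    (S : Finset ι) (x : ι → B) (k : ℕ) : D^[k] (∑ i ∈ S, x i) = ∑ i ∈ S, D^[k] (x i) := by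
  induction k generalizing x with
  | zero => rfl
  | succ k ih => simp only [Function.iterate_succ_apply, map_sum, ih]

theorem pp_iter_mod {R B : Type*} [CommRing R] [CommRing B] [Algebra R B] (D : Derivation R B B)
    (I : Ideal B) (hI : ∀ x ∈ I, D x ∈ I) (v u : B) (hu : D u ∈ I) (k : ℕ) :
    D^[k] (v * u) - D^[k] v * u ∈ I := by
  induction k with
  | zero => simp
  | succ k ih =>
    have h1 := hI _ ih
    rw [map_sub, D.leibniz, smul_eq_mul, smul_eq_mul] at h1
    rw [Function.iterate_succ_apply', Function.iterate_succ_apply']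
    have h2 := I.add_mem h1 (I.mul_mem_left (D^[k] v) hu)
    convert h2 using 1
    ring

section core
variable {R O B G : Type*} [CommRing R] [CommRing O] [CommRing B] [Algebra O[X] B] [Algebra R B]
  [Group G] [Finite G] [MulSemiringAction G B] [SMulCommClass G O[X] B]
  [Algebra.IsInvariant O[X] B G]

/-- the constants -/
noncomputable def ppc (B : Type*) {O : Type*} [CommRing O] [CommRing B] [Algebra O[X] B] : O →+* B :=
  (algebraMap O[X] B).comp C

theorem pp_D_const (D : Derivation R B B) (δ : O[X])
    (hD : ∀ g : O[X], D (algebraMap O[X] B g) = algebraMap O[X] B (δ * derivative g)) (c : O) :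
    D (ppc B c) = 0 := by
  simp [ppc, hD]

theorem pp_I_stable (D : Derivation R B B) (δ : O[X])
    (hD : ∀ g : O[X], D (algebraMap O[X] B g) = algebraMap O[X] B (δ * derivative g))
    (p : Ideal O) :
    ∀ x ∈ (p.map (C : O →+* O[X])).map (algebraMap O[X] B),
      D x ∈ (p.map (C : O →+* O[X])).map (algebraMap O[X] B) := by
  intro x hx
  rw [Ideal.map_map] at hx ⊢
  change x ∈ Ideal.map (ppc B) p at hx
  change D x ∈ Ideal.map (ppc B) p
  rw [Ideal.map] at hx
  induction hx using Submodule.span_induction with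
  | mem x h =>
    obtain ⟨c, _, rfl⟩ := h
    rw [pp_D_const D δ hD]; exact zero_mem _
  | zero => simp
  | add x y _ _ h1 h2 => rw [map_add]; exact add_mem h1 h2
  | smul a x h1 h2 =>
    rw [smul_eq_mul, D.leibniz, smul_eq_mul, smul_eq_mul]
    exact add_mem (Ideal.mul_mem_left _ _ h2) (Ideal.mul_mem_right _ _ h1)

variable {ι ι' : Type*} [Fintype ι] [Fintype ι']

/-- the auxiliary function -/
noncomputable def ppPhi (c : ι → ι' → O) (v : ι → B) (w : ι' → B) (q : ℕ) : B :=
  ∑ i, v i * ∑ j, ppc B (c i j) * w j ^ q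

theorem pp_iter_Phi (D : Derivation R B B) (δ : O[X])
    (hD : ∀ g : O[X], D (algebraMap O[X] B g) = algebraMap O[X] B (δ * derivative g))
    (p : Ideal O) (q : ℕ) (hq : (q : O) ∈ p) (c : ι → ι' → O) (v : ι → B) (w : ι' → B) (k : ℕ) :
    D^[k] (ppPhi c v w q) - ∑ i, D^[k] (v i) * ∑ j, ppc B (c i j) * w j ^ q ∈
      (p.map (C : O →+* O[X])).map (algebraMap O[X] B) := by
  set I := (p.map (C : O →+* O[X])).map (algebraMap O[X] B) with hI
  rw [ppPhi, pp_iter_sum, ← Finset.sum_sub_distrib]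
  refine I.sum_mem fun i _ => pp_iter_mod D I (pp_I_stable D δ hD p) _ _ ?_ k
  rw [map_sum]
  refine I.sum_mem fun j _ => ?_
  rw [D.leibniz, pp_D_const D δ hD, smul_zero, add_zero, D.leibniz_pow]
  refine I.mul_mem_left _ ?_
  rw [nsmul_eq_mul]
  refine I.mul_mem_right _ ?_
  rw [hI, Ideal.map_map]
  have := Ideal.mem_map_of_mem (ppc B) hq
  rw [map_natCast] at this
  exact this

theorem pp_nonvan (D : Derivation R B B) (δ : O[X])
    (hD : ∀ g : O[X], D (algebraMap O[X] B g) = algebraMap O[X] B (δ * derivative g))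
    (p : Ideal O) (ℓ e q : ℕ) (hℓ : ℓ.Prime) (hq : q = ℓ ^ e) (he : e ≠ 0) (hℓp : (ℓ : O) ∈ p)
    (hfr : ∀ u : O, u ^ q - u ∈ p)
    (c : ι → ι' → O) (v : ι → B) (w : ι' → B)
    (r : ℕ) (ω : B) (E : ι → ℕ → B) [DecidableEq ι]
    (hE : ∀ i j, ∑ k ∈ Finset.range r, E i k * D^[k] (v j) = if i = j then ω else 0)
    (P : Ideal B) [P.IsPrime] (hP : P.under O[X] = p.map (C : O →+* O[X]))
    (hG : ((Nat.card G).factorial : O) ∉ p)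
    (hω : ω ∉ P) (hc : ∃ i, ∑ j, ppc B (c i j) * w j ∉ P) : ppPhi c v w q ∉ P := by
  intro hmem
  have hIP : (p.map (C : O →+* O[X])).map (algebraMap O[X] B) ≤ P := by
    rw [← hP]; exact Ideal.map_comap_le
  have hcp : ∀ u : O, u ∈ p → ppc B u ∈ P := fun u hu => hIP (by
    rw [Ideal.map_map]; exact Ideal.mem_map_of_mem (ppc B) hu)
  have hcp' : ∀ u : O, ppc B u ∈ P → u ∈ p := fun u hu => by
    have : C u ∈ P.under O[X] := hu
    rw [hP, Ideal.mem_map_C_iff] at this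
    simpa using this 0
  have hst : ∀ b ∈ P, D b ∈ P := fun b hb => by
    refine pp_stable (A := O[X]) (G := G) D P ?_ ?_ b hb
    · rw [hP]; exact pp_I_stable D δ hD p
    · intro h; apply hG; apply hcp'; rwa [map_natCast]
  have hk : ∀ k, D^[k] (ppPhi c v w q) ∈ P := by
    intro k
    induction k with
    | zero => exact hmem
    | succ k ih => rw [Function.iterate_succ_apply']; exact hst _ ih
  have hk2 : ∀ k, ∑ i, D^[k] (v i) * ∑ j, ppc B (c i j) * w j ^ q ∈ P := fun k => by
    have h1 := hIP (pp_iter_Phi D δ hD p q (by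
      rw [hq, Nat.cast_pow]; exact Ideal.pow_mem_of_mem _ hℓp _ (Nat.pos_of_ne_zero he)) c v w k)
    simpa using P.sub_mem (hk k) h1
  obtain ⟨i, hi⟩ := hc
  have h3 : ω * ∑ j, ppc B (c i j) * w j ^ q ∈ P := by
    have : ω * ∑ j, ppc B (c i j) * w j ^ q = ∑ k ∈ Finset.range r, E i k *
        ∑ i', D^[k] (v i') * ∑ j, ppc B (c i' j) * w j ^ q := by
      simp only [Finset.mul_sum (s := (Finset.univ : Finset ι))]
      rw [Finset.sum_comm]
      simp only [← mul_assoc, ← Finset.sum_mul, hE]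
      simp
    rw [this]
    exact P.sum_mem fun k _ => P.mul_mem_left _ (hk2 k)
  have h4 := (Ideal.IsPrime.mem_or_mem inferInstance h3).resolve_left hω
  apply hi
  apply Ideal.IsPrime.mem_of_pow_mem (I := P) inferInstance q
  rw [← Ideal.Quotient.eq_zero_iff_mem] at h4 ⊢
  have : Fact ℓ.Prime := ⟨hℓ⟩
  have : CharP (B ⧸ P) ℓ := by
    have h0 : ((ℓ : ℕ) : B ⧸ P) = 0 := by
      have := hcp _ hℓp
      rw [map_natCast, ← Ideal.Quotient.eq_zero_iff_mem, map_natCast] at this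
      exact this
    exact (CharP.charP_iff_prime_eq_zero hℓ).mpr h0
  rw [map_pow, map_sum, hq, sum_pow_char_pow, ← h4, map_sum]
  refine Finset.sum_congr rfl fun j _ => ?_
  rw [← map_pow, mul_pow, map_mul, map_mul, hq]
  congr 1
  rw [← hq, ← map_pow, Ideal.Quotient.eq, ← map_sub]
  exact hcp _ (hfr _)

end core

end part2

section part3

section core
variable {R O B G : Type*} [CommRing R] [CommRing O] [CommRing B] [Algebra O[X] B] [Algebra R B]
  [Group G] [Fintype G] [MulSemiringAction G B] [SMulCommClass G O[X] B]
  [Algebra.IsInvariant O[X] B G]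
variable {ι ι' : Type*} [Fintype ι] [Fintype ι']

/-- evaluation at a point of the residue field -/
noncomputable def ppev {O : Type*} [CommRing O] (p : Ideal O) (a : O ⧸ p) : O[X] →+* O ⧸ p :=
  eval₂RingHom (Ideal.Quotient.mk p) a

theorem ppev_surj {O : Type*} [CommRing O] (p : Ideal O) (a : O ⧸ p) :
    Function.Surjective (ppev p a) := by
  intro b
  obtain ⟨c, rfl⟩ := Ideal.Quotient.mk_surjective b
  exact ⟨C c, by simp [ppev]⟩

theorem pp_sum_mult {κ : Type*} [Field κ] (N : κ[X]) (S : Finset κ) (r : ℕ)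
    (h : ∀ a ∈ S, r ≤ N.rootMultiplicity a) : r * S.card ≤ N.natDegree := by
  classical
  have h1 : r * S.card ≤ ∑ a ∈ S, N.roots.count a := by
    rw [mul_comm, ← smul_eq_mul]
    exact Finset.card_nsmul_le_sum _ _ _ fun a ha => by rw [count_roots]; exact h a ha
  refine h1.trans (le_trans ?_ (card_roots' N))
  rw [← Multiset.toFinset_sum_count_eq N.roots]
  rw [← Finset.sum_filter_add_sum_filter_not S (fun a => a ∈ N.roots)]
  have : ∑ a ∈ S with a ∉ N.roots, N.roots.count a = 0 :=
    Finset.sum_eq_zero fun a ha => Multiset.count_eq_zero.mpr (Finset.mem_filter.mp ha).2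
  rw [this, add_zero]
  exact Finset.sum_le_sum_of_subset fun a ha => by
    simpa using (Finset.mem_filter.mp ha).2

theorem pp_smul_iter (D : Derivation R B B) (hcomm : ∀ (g : G) (b : B), D (g • b) = g • D b)
    (g : G) (b : B) (k : ℕ) : D^[k] (g • b) = g • D^[k] b := by
  induction k with
  | zero => rfl
  | succ k ih => rw [Function.iterate_succ_apply', Function.iterate_succ_apply', ih, hcomm]

theorem pp_smul_ppc (g : G) (c : O) : g • (ppc B c) = ppc B c := by
  change g • (algebraMap O[X] B (C c)) = algebraMap O[X] B (C c)
  exact smul_algebraMap g _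

theorem pp_core (D : Derivation R B B) (δ : O[X])
    (hD : ∀ g : O[X], D (algebraMap O[X] B g) = algebraMap O[X] B (δ * derivative g))
    (hcomm : ∀ (g : G) (b : B), D (g • b) = g • D b)
    (p : Ideal O) [p.IsMaximal] [Finite (O ⧸ p)] [Module.Finite O[X] B] [FaithfulSMul O[X] B]
    (q : ℕ) (hq : q = Nat.card (O ⧸ p)) (hqp : (q : O) ∈ p)
    (M : ℕ) (hM : ((M * Nat.card G).factorial : O) ∉ p)
    (c : G → ι → ι' → O) (v : ι → B) (w : ι' → B)
    (haux : ∀ σ : G, ∀ k < M, ∑ i, D^[k] (v i) * ∑ j, ppc B (c σ i j) * σ • w j = 0)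
    (T : Finset G) (hT : ∀ σ ∈ T, ∀ τ : G, τ⁻¹ * σ * τ ∈ T)
    (hgood : ∀ P : Ideal B, P.IsPrime → P.under O[X] = p.map (C : O →+* O[X]) →
      ∀ σ, ppPhi (c σ) v w q ∉ P)
    (S : ℕ) (hdeg : ∀ N : O[X], algebraMap O[X] B N = ∏ σ ∈ T, ∏ τ : G, τ • ppPhi (c σ) v w q →
      N.natDegree ≤ S)
    (Im : Finset (O ⧸ p)) (hIm : ∀ a ∈ Im, ppev p a δ ≠ 0)
    (hIm2 : ∀ a ∈ Im, ∀ Q : Ideal B, Q.IsPrime → Q.under O[X] = RingHom.ker (ppev p a) →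
      ∀ σ : G, (∀ b : B, σ • b - b ^ q ∈ Q) → σ ∈ T) :
    M * Nat.card G * Im.card ≤ S := by
  classical
  letI : Field (O ⧸ p) := Ideal.Quotient.field p
  have hIntegral : Algebra.IsIntegral O[X] B := inferInstance
  have hover : ∀ J : Ideal O[X], J.IsPrime → ∃ P : Ideal B, P.IsPrime ∧ P.under O[X] = J := by
    intro J hJ
    obtain ⟨P, -, hP1, hP2⟩ := Ideal.exists_ideal_over_prime_of_isIntegral (S := B) J ⊥ (by
      intro x hx
      rw [Ideal.mem_comap, Ideal.mem_bot] at hx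
      rw [FaithfulSMul.algebraMap_injective O[X] B (hx.trans (map_zero _).symm)]
      exact zero_mem _)
    exact ⟨P, hP1, hP2⟩
  set F : B := ∏ σ ∈ T, ∏ τ : G, τ • ppPhi (c σ) v w q with hF
  obtain ⟨N, hN⟩ : ∃ N, algebraMap O[X] B N = F := by
    apply Algebra.IsInvariant.isInvariant (G := G)
    intro g
    rw [hF, Finset.smul_prod']
    refine Finset.prod_congr rfl fun σ _ => ?_
    rw [Finset.smul_prod']
    simp only [smul_smul]
    exact Fintype.prod_equiv (Equiv.mulLeft g) _ _ fun τ => rfl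
  have hN0 : N.map (Ideal.Quotient.mk p) ≠ 0 := by
    intro h0
    have hNp : N ∈ p.map (C : O →+* O[X]) := by
      rw [Ideal.mem_map_C_iff]
      intro n
      rw [← Ideal.Quotient.eq_zero_iff_mem, ← coeff_map, h0, coeff_zero]
    have hprime : (p.map (C : O →+* O[X])).IsPrime := Ideal.isPrime_map_C_of_isPrime
    obtain ⟨P, hP1, hP2⟩ := hover (p.map (C : O →+* O[X])) hprime
    have hFP : F ∈ P := by
      rw [← hN]
      have : N ∈ P.under O[X] := by rw [hP2]; exact hNp
      exact this
    rw [hF] at hFP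
    obtain ⟨σ, -, hσ⟩ := (Ideal.IsPrime.prod_mem_iff (p := P)).mp hFP
    obtain ⟨τ, -, hτ⟩ := (Ideal.IsPrime.prod_mem_iff (p := P)).mp hσ
    refine hgood (P.comap (MulSemiringAction.toRingHom G B τ)) inferInstance ?_ σ hτ
    rw [← hP2]
    ext x
    change τ • algebraMap O[X] B x ∈ P ↔ algebraMap O[X] B x ∈ P
    rw [smul_algebraMap]
  refine le_trans ?_ ((natDegree_map_le (f := Ideal.Quotient.mk p) (p := N)).trans (hdeg N hN))
  refine pp_sum_mult _ _ _ fun a ha => ?_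
  refine pp_mult (δ.map (Ideal.Quotient.mk p)) _ a _ ?_ ?_ hN0 ?_
  · simpa [ppev, eval_map] using hIm a ha
  · intro h; apply hM; rw [← Ideal.Quotient.eq_zero_iff_mem, map_natCast]; exact h
  intro k hk
  have hker : (RingHom.ker (ppev p a)).IsMaximal :=
    RingHom.ker_isMaximal_of_surjective _ (ppev_surj p a)
  obtain ⟨Q, hQ1, hQ2⟩ : ∃ Q : Ideal B, Q.IsPrime ∧ Q.under O[X] = RingHom.ker (ppev p a) :=
    hover _ hker.isPrime
  have hcard : Nat.card (O[X] ⧸ Q.under O[X]) = q := by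
    rw [hQ2, hq]
    exact Nat.card_congr (RingHom.quotientKerEquivOfSurjective (ppev_surj p a)).toEquiv
  have hfin : Finite (B ⧸ Q) := by
    have : Finite (O[X] ⧸ Q.under O[X]) := Nat.finite_of_card_ne_zero (by
      rw [hcard, hq]; exact Nat.card_pos.ne')
    exact Module.finite_of_finite (O[X] ⧸ Q.under O[X])
  obtain ⟨σ, hσ⟩ := IsArithFrobAt.exists_of_isInvariant O[X] G Q
  have hσ' : ∀ b : B, σ • b - b ^ q ∈ Q := fun b => by
    have := hσ b
    rw [hcard] at this
    exact this
  have hσT := hIm2 a ha Q hQ1 hQ2 σ hσ'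
  have hIQ : (p.map (C : O →+* O[X])).map (algebraMap O[X] B) ≤ Q := by
    rw [Ideal.map_le_iff_le_comap]
    change _ ≤ Q.under O[X]
    rw [hQ2, Ideal.map_le_iff_le_comap]
    intro x hx
    rw [Ideal.mem_comap, RingHom.mem_ker]
    simpa [ppev, Ideal.Quotient.eq_zero_iff_mem] using hx
  have hvan : ∀ τ : G, ∀ k < M, D^[k] (τ • ppPhi (c (τ⁻¹ * σ * τ)) v w q) ∈ Q := by
    intro τ k hk
    rw [pp_smul_iter D hcomm]
    have h1 := pp_iter_Phi D δ hD p q hqp (c (τ⁻¹ * σ * τ)) v w k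
    have h2 : τ • (D^[k] (ppPhi (c (τ⁻¹ * σ * τ)) v w q) -
        ∑ i, D^[k] (v i) * ∑ j, ppc B (c (τ⁻¹ * σ * τ) i j) * w j ^ q) ∈
        (p.map (C : O →+* O[X])).map (algebraMap O[X] B) := by
      have h3 := Ideal.mem_map_of_mem (MulSemiringAction.toRingHom G B τ) h1
      rw [Ideal.map_map] at h3
      have h4 : (MulSemiringAction.toRingHom G B τ).comp (algebraMap O[X] B) = algebraMap O[X] B := by
        refine RingHom.ext fun x => ?_
        exact smul_algebraMap τ x
      rw [h4] at h3
      exact h3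
    rw [smul_sub] at h2
    have h5 := hIQ h2
    have h6 : τ • ∑ i, D^[k] (v i) * ∑ j, ppc B (c (τ⁻¹ * σ * τ) i j) * w j ^ q ∈ Q := by
      have h7 := congrArg (fun x => τ • x) (haux (τ⁻¹ * σ * τ) k hk)
      simp only [smul_zero, Finset.smul_sum, smul_mul', pp_smul_ppc, smul_smul] at h7
      rw [← neg_mem_iff, ← zero_sub, ← h7]
      simp only [smul_zero, Finset.smul_sum, smul_mul', pp_smul_ppc, smul_smul]
      rw [← Finset.sum_sub_distrib]
      refine Q.sum_mem fun i _ => ?_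
      rw [← mul_sub]
      refine Q.mul_mem_left _ ?_
      rw [← Finset.sum_sub_distrib]
      refine Q.sum_mem fun j _ => ?_
      rw [← mul_sub]
      refine Q.mul_mem_left _ ?_
      have h8 := hσ' (τ • w j)
      rw [smul_smul] at h8
      rw [smul_pow']
      have h9 : τ * (τ⁻¹ * σ * τ) = σ * τ := by group
      rw [h9]
      exact h8
    simpa using Q.add_mem h5 h6
  have hFk : D^[k] F ∈ Q := by
    rw [hF, ← Finset.prod_product']
    refine pp_ord_prod D Q (T ×ˢ Finset.univ)
      (fun x => if x.1 = x.2⁻¹ * σ * x.2 then M else 0) _ ?_ k ?_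
    · rintro ⟨s, τ⟩ _ k hk
      dsimp only at hk ⊢
      split_ifs at hk with h
      · rw [h]; exact hvan τ k hk
      · omega
    · rw [Finset.sum_product_right]
      refine lt_of_lt_of_le hk (le_of_eq ?_)
      have : ∀ τ : G, (∑ x ∈ T, if x = τ⁻¹ * σ * τ then M else 0) = M := fun τ => by
        rw [Finset.sum_ite_eq']; simp [hT σ hσT τ]
      simp only [this, Finset.sum_const, Finset.card_univ, smul_eq_mul, Nat.card_eq_fintype_card]
      ring
  have hit : ∀ k, D^[k] (algebraMap O[X] B N) =
      algebraMap O[X] B ((fun g => δ * derivative g)^[k] N) := by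
    intro k
    induction k with
    | zero => rfl
    | succ k ih => rw [Function.iterate_succ_apply', Function.iterate_succ_apply', ih, hD]
  have hit2 : ∀ k, ((fun g => δ.map (Ideal.Quotient.mk p) * derivative g)^[k]
      (N.map (Ideal.Quotient.mk p))) = ((fun g => δ * derivative g)^[k] N).map (Ideal.Quotient.mk p) := by
    intro k
    induction k with
    | zero => rfl
    | succ k ih => rw [Function.iterate_succ_apply', Function.iterate_succ_apply', ih]; simp
  rw [hit2, eval_map]
  rw [← hN, hit] at hFk
  have h5 : (fun g => δ * derivative g)^[k] N ∈ Q.under O[X] := hFk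
  rw [hQ2, RingHom.mem_ker] at h5
  exact h5
end core

end part3

section part4

theorem pp_frob_fix {O B G : Type*} [CommRing O] [CommRing B] [Algebra O[X] B]
    [Group G] [MulSemiringAction G B] [SMulCommClass G O[X] B]
    (lc : O) (F : O[X]) (e : ℕ) (Z : Multiset B)
    (hZ : ∀ u : O, (Z.map (fun z => ppc B (lc * u) - z)).prod =
      ppc B (lc ^ e) * (ppc B (F.eval u) - algebraMap O[X] B X))
    (θ : O[X]) (hθ : ∀ σ : G, ∀ z ∈ Z, σ • z ≠ z → (σ • z - z) ∣ algebraMap O[X] B θ)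
    (p : Ideal O) (q : ℕ) (hfr : ∀ u : O, u ^ q - u ∈ p) (a : O ⧸ p) (ha : ppev p a θ ≠ 0)
    (ha2 : ∃ c : O ⧸ p, (F.map (Ideal.Quotient.mk p)).eval c = a)
    (Q : Ideal B) (hQ : Q.IsPrime) (hQ2 : Q.under O[X] = RingHom.ker (ppev p a))
    (σ : G) (hσ : ∀ b : B, σ • b - b ^ q ∈ Q) : ∃ z ∈ Z, σ • z = z := by
  obtain ⟨c, hc⟩ := ha2
  obtain ⟨u, rfl⟩ := Ideal.Quotient.mk_surjective c
  have hmem : ∀ g : O[X], algebraMap O[X] B g ∈ Q ↔ ppev p a g = 0 := fun g => by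
    rw [← RingHom.mem_ker, ← hQ2]; rfl
  have h1 : ppc B (F.eval u) - algebraMap O[X] B X ∈ Q := by
    change algebraMap O[X] B (C (F.eval u)) - algebraMap O[X] B X ∈ Q
    rw [← map_sub, hmem]
    rw [eval_map, eval₂_hom] at hc
    simp [ppev, hc]
  have h2 := Q.mul_mem_left (ppc B (lc ^ e)) h1
  rw [← hZ] at h2
  rw [hQ.multiset_prod_mem_iff_exists_mem] at h2
  obtain ⟨x, hx, hz2⟩ := h2
  obtain ⟨z, hz, rfl⟩ := Multiset.mem_map.mp hx
  refine ⟨z, hz, ?_⟩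
  by_contra hne
  have h3 : ppc B ((lc * u) ^ q - lc * u) ∈ Q := by
    change algebraMap O[X] B (C _) ∈ Q
    rw [hmem]
    rw [ppev, coe_eval₂RingHom, eval₂_C]
    exact Ideal.Quotient.eq_zero_iff_mem.mpr (hfr (lc * u))
  rw [map_sub, map_pow] at h3
  rw [← Ideal.Quotient.eq_zero_iff_mem, map_sub] at h3 hz2
  have h4 := hσ z
  rw [← Ideal.Quotient.eq_zero_iff_mem, map_sub] at h4
  have h5 : σ • z - z ∈ Q := by
    rw [← Ideal.Quotient.eq_zero_iff_mem, map_sub]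
    rw [map_pow] at h3 h4
    rw [sub_eq_zero] at hz2 h3 h4 ⊢
    rw [h4, ← hz2, h3]
  obtain ⟨y, hy⟩ := hθ σ z hz hne
  apply ha
  rw [← hmem, hy]
  exact Q.mul_mem_right _ h5

theorem pp_wr_indep {R L ι : Type*} [CommRing R] [Field L] [Algebra R L] [Fintype ι]
    (D : Derivation R L L) (v : ι → L)
    (hv : ∀ a : ι → L, (∀ i, D (a i) = 0) → ∑ i, a i * v i = 0 → a = 0) :
    ∀ (n : ℕ) (a : ι → L), (Function.support a).ncard ≤ n → (∀ k, ∑ i, a i * D^[k] (v i) = 0) →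
      a = 0 := by
  intro n
  induction n with
  | zero =>
    intro a ha _
    have : (Function.support a).ncard = 0 := by omega
    rw [Set.ncard_eq_zero] at this
    simpa using this
  | succ n ih =>
    intro a ha hk
    by_contra hne
    obtain ⟨i0, hi0⟩ : ∃ i, a i ≠ 0 := by
      by_contra h; push Not at h; exact hne (funext h)
    set b : ι → L := fun i => a i / a i0 with hb
    have hbk : ∀ k, ∑ i, b i * D^[k] (v i) = 0 := fun k => by
      have : ∑ i, b i * D^[k] (v i) = (a i0)⁻¹ * ∑ i, a i * D^[k] (v i) := by
        rw [Finset.mul_sum]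
        exact Finset.sum_congr rfl fun i _ => by simp only [hb]; field_simp
      rw [this, hk, mul_zero]
    have hb0 : b i0 = 1 := div_self hi0
    have hDb : (fun i => D (b i)) = 0 := by
      apply ih
      · have : (Function.support fun i => D (b i)) ⊂ Function.support a := by
          refine ⟨fun i hi => ?_, fun h => ?_⟩
          · simp only [Function.mem_support] at hi ⊢
            intro h; apply hi; simp [hb, h]
          · have := h (show i0 ∈ Function.support a from hi0)
            simp [hb0] at this
        have := Set.ncard_lt_ncard this (Set.toFinite _)
        omega
      · intro k
        have h1 := congrArg D (hbk k)
        rw [map_sum, map_zero] at h1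
        have h2 := hbk (k + 1)
        simp only [Function.iterate_succ_apply'] at h2
        rw [← h1, ← sub_zero (∑ i, D (b i * _)), ← h2, ← Finset.sum_sub_distrib]
        refine Finset.sum_congr rfl fun i _ => ?_
        rw [D.leibniz, smul_eq_mul, smul_eq_mul]
        ring
    have := hv b (fun i => congrFun hDb i) (hbk 0)
    rw [this] at hb0
    simp at hb0

theorem pp_wronskian {R L ι : Type*} [CommRing R] [Field L] [Algebra R L] [Fintype ι]
    [DecidableEq ι] (D : Derivation R L L) (v : ι → L)
    (hv : ∀ a : ι → L, (∀ i, D (a i) = 0) → ∑ i, a i * v i = 0 → a = 0) :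
    ∃ (r : ℕ) (E : ι → ℕ → L), ∀ i j, ∑ k ∈ Finset.range r, E i k * D^[k] (v j) =
      if i = j then 1 else 0 := by
  classical
  set s : ℕ → ι → L := fun k j => D^[k] (v j) with hs
  have htop : Submodule.span L (Set.range s) = ⊤ := by
    by_contra hne
    obtain ⟨φ, hφ, hφ2⟩ := Submodule.exists_le_ker_of_lt_top _ (lt_top_iff_ne_top.mpr hne)
    apply hφ
    have h0 : (fun i => φ (Pi.single i 1)) = 0 := by
      refine pp_wr_indep D v hv _ _ le_rfl fun k => ?_
      have h1 : φ (s k) = 0 := hφ2 (Submodule.subset_span ⟨k, rfl⟩)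
      rw [pi_eq_sum_univ' (s k)] at h1
      rw [← h1, map_sum]
      refine Finset.sum_congr rfl fun i _ => ?_
      rw [map_smul, smul_eq_mul, mul_comm]
    refine LinearMap.pi_ext' fun i => LinearMap.ext_ring ?_
    simpa using congrFun h0 i
  have h1 : ∀ i, ∃ c : ℕ →₀ L, c.sum (fun k a => a • s k) = Pi.single i 1 := fun i => by
    rw [← Finsupp.mem_span_range_iff_exists_finsupp, htop]; trivial
  choose c hc using h1
  obtain ⟨r, hr⟩ : ∃ r, ∀ i, (c i).support ⊆ Finset.range r := by
    refine ⟨(Finset.univ.biUnion fun i => (c i).support).sup id + 1, fun i k hk => ?_⟩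
    rw [Finset.mem_range, Nat.lt_succ_iff]
    exact Finset.le_sup (f := id) (Finset.mem_biUnion.mpr ⟨i, Finset.mem_univ _, hk⟩)
  refine ⟨r, fun i k => c i k, fun i j => ?_⟩
  have h2 := congrFun (hc i) j
  rw [Finsupp.sum_of_support_subset _ (hr i) _ (by simp)] at h2
  simp only [Finset.sum_apply, Pi.smul_apply, smul_eq_mul, hs] at h2
  rw [h2, Pi.single_apply]
  simp [eq_comm]

end part4

section part5

theorem pp_val {K L : Type*} [Field K] [Field L] [Algebra K[X] L]
    (hinj : Function.Injective (algebraMap K[X] L)) :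
    ∃ W : ValuationSubring L, 1 < W.valuation (algebraMap K[X] L X) ∧
      ∀ c : K, W.valuation (algebraMap K[X] L (C c)) ≤ 1 := by
  letI : Algebra K L := ((algebraMap K[X] L).comp C).toAlgebra
  set t := algebraMap K[X] L X with ht
  have hev : ∀ g : K[X], aeval t g = algebraMap K[X] L g := fun g => by
    have : (aeval t : K[X] →ₐ[K] L).toRingHom = algebraMap K[X] L := by
      apply Polynomial.ringHom_ext
      · intro c; simp; rfl
      · simp [ht]
    exact congrArg (fun φ => φ g) this
  have htr : Transcendental K t := by
    rw [transcendental_iff]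
    intro p hp
    rw [hev] at hp
    exact (map_eq_zero_iff _ hinj).mp hp
  have ht0 : t ≠ 0 := by
    intro h; apply htr; rw [h]; exact isAlgebraic_zero
  set A : Subring L := (aeval t⁻¹ : K[X] →ₐ[K] L).toRingHom.range with hA
  have hmem : t⁻¹ ∈ A := ⟨X, by simp⟩
  have hI : Ideal.span {(⟨t⁻¹, hmem⟩ : A)} ≠ ⊤ := by
    intro h
    rw [Ideal.eq_top_iff_one, Ideal.mem_span_singleton'] at h
    obtain ⟨⟨_, g, rfl⟩, hg⟩ := h
    have hg2 := congrArg Subtype.val hg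
    simp only [Subring.coe_mul, Subring.coe_one] at hg2
    apply htr
    rw [← inv_inv t]
    apply IsAlgebraic.inv
    refine ⟨g * X - 1, fun h0 => ?_, ?_⟩
    · have := congrArg (eval 0) h0
      simp at this
    · rw [map_sub, map_mul, aeval_X, map_one, sub_eq_zero]
      exact hg2
  obtain ⟨W, hW1, hW2⟩ := Ideal.image_subset_nonunits_valuationSubring _ hI
  refine ⟨W, ?_, fun c => ?_⟩
  · have h1 : t⁻¹ ∈ W.nonunits := hW2 ⟨⟨t⁻¹, hmem⟩, Ideal.mem_span_singleton_self _, rfl⟩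
    rw [ValuationSubring.mem_nonunits_iff, map_inv₀] at h1
    have h2 : W.valuation t ≠ 0 := by simpa using ht0
    exact (inv_lt_one₀ (zero_lt_iff.mpr h2)).mp h1
  · rw [ValuationSubring.valuation_le_one_iff]
    exact hW1 ⟨C c, by simp; rfl⟩

theorem pp_val_le {K L Γ : Type*} [Field K] [Field L] [Algebra K[X] L]
    [LinearOrderedCommGroupWithZero Γ] (V : Valuation L Γ)
    (h1 : 1 < V (algebraMap K[X] L X)) (h2 : ∀ c : K, V (algebraMap K[X] L (C c)) ≤ 1)
    (g : K[X]) (n : ℕ) (hg : g.natDegree ≤ n) :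
    V (algebraMap K[X] L g) ≤ V (algebraMap K[X] L X) ^ n := by
  rw [g.as_sum_range_C_mul_X_pow, map_sum]
  refine V.map_sum_le fun i hi => ?_
  rw [map_mul, map_mul, map_pow, map_pow]
  refine (mul_le_of_le_one_left' (h2 _)).trans ?_
  refine pow_le_pow_right₀ h1.le ?_
  rw [Finset.mem_range] at hi
  omega

theorem pp_val_eq {K L Γ : Type*} [Field K] [Field L] [Algebra K[X] L]
    [LinearOrderedCommGroupWithZero Γ] (V : Valuation L Γ)
    (h1 : 1 < V (algebraMap K[X] L X)) (h2 : ∀ c : K, V (algebraMap K[X] L (C c)) ≤ 1)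
    (g : K[X]) (n : ℕ) (hg0 : g ≠ 0) (hg : V (algebraMap K[X] L g) ≤ V (algebraMap K[X] L X) ^ n) :
    g.natDegree ≤ n := by
  have hc : ∀ c : K, c ≠ 0 → V (algebraMap K[X] L (C c)) = 1 := fun c hc => by
    apply le_antisymm (h2 c)
    have h3 : V (algebraMap K[X] L (C c)) * V (algebraMap K[X] L (C c⁻¹)) = 1 := by
      rw [← map_mul, ← map_mul, ← C_mul, mul_inv_cancel₀ hc]; simp
    rw [← h3]
    exact mul_le_of_le_one_right' (h2 _)
  by_contra hlt
  push Not at hlt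
  have hlead : V (algebraMap K[X] L (C g.leadingCoeff * X ^ g.natDegree)) =
      V (algebraMap K[X] L X) ^ g.natDegree := by
    rw [map_mul, map_mul, hc _ (leadingCoeff_ne_zero.mpr hg0), one_mul, map_pow, map_pow]
  have h3 : V (algebraMap K[X] L g.eraseLead) < V (algebraMap K[X] L X) ^ g.natDegree := by
    refine (pp_val_le V h1 h2 _ _ (eraseLead_natDegree_le g)).trans_lt ?_
    exact pow_lt_pow_right₀ h1 (by omega)
  have h4 : V (algebraMap K[X] L g) = V (algebraMap K[X] L X) ^ g.natDegree := by
    conv_lhs => rw [← eraseLead_add_C_mul_X_pow g, map_add]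
    rw [← hlead] at h3 ⊢
    exact V.map_add_eq_of_lt_right h3
  rw [h4] at hg
  exact absurd (pow_lt_pow_right₀ h1 hlt) (not_lt.mpr hg)

theorem pp_val_int {K L Γ : Type*} [Field K] [Field L] [Algebra K[X] L]
    [LinearOrderedCommGroupWithZero Γ] (V : Valuation L Γ)
    (h1 : 1 < V (algebraMap K[X] L X)) (h2 : ∀ c : K, V (algebraMap K[X] L (C c)) ≤ 1)
    (b : L) (hb : IsIntegral K[X] b) : ∃ γ : ℕ, V b ≤ V (algebraMap K[X] L X) ^ γ := by
  obtain ⟨g, hg, hgb⟩ := hb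
  set γ := g.support.sup (fun i => (g.coeff i).natDegree) with hγ
  refine ⟨γ, ?_⟩
  by_contra hlt
  push Not at hlt
  have hone : 1 ≤ V b := (one_le_pow₀ h1.le).trans hlt.le
  have hpos : 0 < V b := zero_lt_one.trans_le hone
  rw [hg.as_sum, eval₂_add, eval₂_X_pow, eval₂_finsetSum] at hgb
  have h3 : V (∑ i ∈ Finset.range g.natDegree, eval₂ (algebraMap K[X] L) b (C (g.coeff i) * X ^ i))
      < V b ^ g.natDegree := by
    refine V.map_sum_lt (pow_pos hpos _).ne' fun i hi => ?_
    rw [Finset.mem_range] at hi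
    rw [eval₂_mul, eval₂_C, eval₂_X_pow, map_mul, map_pow]
    calc _ ≤ V (algebraMap K[X] L X) ^ γ * V b ^ i := by
          refine mul_le_mul_left (pp_val_le V h1 h2 _ _ ?_) _
          by_cases h : i ∈ g.support
          · exact Finset.le_sup (f := fun i => (g.coeff i).natDegree) h
          · rw [notMem_support_iff] at h; simp [h]
      _ < V b * V b ^ i := mul_lt_mul_of_pos_right hlt (pow_pos hpos _)
      _ = V b ^ (i + 1) := by rw [pow_succ']
      _ ≤ _ := pow_le_pow_right₀ hone (by omega)
  rw [add_eq_zero_iff_eq_neg] at hgb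
  rw [← V.map_neg, ← hgb, map_pow] at h3
  exact lt_irrefl _ h3

theorem pp_degbound {O K L B G Γ ι ι' : Type*} [CommRing O] [Field K] [Algebra O K]
    [Field L] [Algebra K[X] L] [Algebra O[X] L] [CommRing B] [Algebra O[X] B] [Algebra B L]
    [IsScalarTower O[X] B L] [Fintype ι] [Fintype ι'] [Group G] [Fintype G]
    [MulSemiringAction G B] [SMulCommClass G O[X] B] [Algebra.IsInvariant O[X] B G]
    [LinearOrderedCommGroupWithZero Γ] (hOK : Function.Injective (algebraMap O K))
    (hcompat : ∀ g : O[X], algebraMap O[X] L g = algebraMap K[X] L (g.map (algebraMap O K)))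
    (V : Valuation L Γ)
    (h1 : 1 < V (algebraMap K[X] L X)) (h2 : ∀ c : K, V (algebraMap K[X] L (C c)) ≤ 1)
    (v : ι → B) (w : ι' → B) (a b q : ℕ)
    (hv : ∀ (τ : G) i, V (algebraMap B L (τ • v i)) ≤ V (algebraMap K[X] L X) ^ a)
    (hw : ∀ (τ : G) i, V (algebraMap B L (τ • w i)) ≤ V (algebraMap K[X] L X) ^ b)
    (c : G → ι → ι' → O) (T : Finset G) (N : O[X])
    (hN : algebraMap O[X] B N = ∏ σ ∈ T, ∏ τ : G, τ • ppPhi (c σ) v w q) :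
    N.natDegree ≤ T.card * Nat.card G * (a + q * b) := by
  by_cases hN0 : N = 0
  · simp [hN0]
  set t := V (algebraMap K[X] L X) with ht
  have hc : ∀ (x : O) , V (algebraMap B L (ppc B x)) ≤ 1 := fun x => by
    rw [ppc, RingHom.comp_apply, ← IsScalarTower.algebraMap_apply, hcompat, map_C]
    exact h2 _
  have hPhi : ∀ σ τ : G, V (algebraMap B L (τ • ppPhi (c σ) v w q)) ≤ t ^ (a + q * b) := fun σ τ => by
    rw [ppPhi, Finset.smul_sum, map_sum]
    refine V.map_sum_le fun i _ => ?_
    rw [smul_mul', map_mul, map_mul, pow_add]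
    refine mul_le_mul' (hv τ i) ?_
    rw [Finset.smul_sum, map_sum]
    refine V.map_sum_le fun j _ => ?_
    rw [smul_mul', map_mul, map_mul, smul_pow', map_pow, map_pow, pp_smul_ppc]
    refine (mul_le_of_le_one_left' (hc _)).trans ?_
    rw [mul_comm q b, pow_mul]
    exact pow_le_pow_left' (hw τ j) q
  have hb : V (algebraMap K[X] L (N.map (algebraMap O K))) ≤
      t ^ (T.card * Nat.card G * (a + q * b)) := by
    rw [← hcompat, IsScalarTower.algebraMap_apply O[X] B L, hN, map_prod, map_prod]
    calc _ ≤ ∏ σ ∈ T, t ^ (Nat.card G * (a + q * b)) := by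
          refine Finset.prod_le_prod' fun σ _ => ?_
          rw [map_prod, map_prod]
          calc _ ≤ ∏ τ : G, t ^ (a + q * b) := Finset.prod_le_prod' fun τ _ => hPhi σ τ
            _ = t ^ (Nat.card G * (a + q * b)) := by
                rw [Finset.prod_const, Finset.card_univ, ← pow_mul, mul_comm,
                          Nat.card_eq_fintype_card]
      _ = _ := by rw [Finset.prod_const, ← pow_mul]; congr 1; ring
  have := pp_val_eq V h1 h2 _ _ ((Polynomial.map_ne_zero_iff hOK).mpr hN0) hb
  rwa [natDegree_map_eq_of_injective hOK] at this

end part5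

section part6

section derivconstr
universe u
variable {K Ft L : Type u} [Field K] [Field Ft] [Field L] [CharZero K] [Algebra K[X] Ft]
  [IsFractionRing K[X] Ft] [Algebra Ft L] [Algebra K[X] L] [IsScalarTower K[X] Ft L] [Algebra K L]
  [IsScalarTower K K[X] L] [FiniteDimensional Ft L] [Algebra.IsSeparable Ft L]

include Ft in
variable (K Ft L) in
theorem pp_etale : Algebra.FormallyEtale K[X] L := by
  have : Algebra.FormallyEtale K[X] Ft := Algebra.FormallyEtale.of_isLocalization (nonZeroDivisors K[X])
  have : Algebra.FormallyEtale Ft L := Algebra.FormallyEtale.of_isSeparable Ft L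
  exact Algebra.FormallyEtale.comp K[X] Ft L

include Ft in
variable (K Ft L) in
theorem pp_deriv : ∃ D0 : Derivation K L L, ∀ g : K[X],
    D0 (algebraMap K[X] L g) = algebraMap K[X] L (derivative g) := by
  have := pp_etale K Ft L
  have hb := KaehlerDifferential.isBaseChange_of_formallyEtale K K[X] L
  let d1 : Derivation K K[X] L := Polynomial.mkDerivation K (1 : L)
  let φ := hb.lift d1.liftKaehlerDifferential
  refine ⟨φ.compDer (KaehlerDifferential.D K L), fun g => ?_⟩
  have h1 : KaehlerDifferential.D K L (algebraMap K[X] L g) =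
      KaehlerDifferential.map K K K[X] L (KaehlerDifferential.D K K[X] g) := by simp
  change φ (KaehlerDifferential.D K L _) = _
  rw [h1, hb.lift_eq]
  simp [d1, mkDerivation_apply, Algebra.smul_def]

include Ft in
theorem pp_deriv_unique (D1 D2 : Derivation K L L)
    (h : ∀ g : K[X], D1 (algebraMap K[X] L g) = D2 (algebraMap K[X] L g)) : D1 = D2 := by
  have := pp_etale K Ft L
  have hb := KaehlerDifferential.isBaseChange_of_formallyEtale K K[X] L
  have h1 : D1.liftKaehlerDifferential = D2.liftKaehlerDifferential := by
    apply hb.algHom_ext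
    intro x
    have hx : x ∈ Submodule.span K[X] (Set.range (KaehlerDifferential.D K K[X])) := by
      rw [KaehlerDifferential.span_range_derivation]; trivial
    induction hx using Submodule.span_induction with
    | mem x hx =>
      obtain ⟨g, rfl⟩ := hx
      simp [h]
    | zero => simp
    | add x y _ _ hx hy => rw [map_add, map_add, map_add, hx, hy]
    | smul a x _ hx => 
      rw [map_smul, ← algebraMap_smul L a, map_smul, map_smul, hx]
  ext x
  rw [← D1.liftKaehlerDifferential_comp_D, h1, D2.liftKaehlerDifferential_comp_D]

theorem pp_deriv_comm (D0 : Derivation K L L) (hD0 : ∀ g : K[X],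
    D0 (algebraMap K[X] L g) = algebraMap K[X] L (derivative g)) (σ : L ≃ₐ[Ft] L) (x : L) :
    D0 (σ x) = σ (D0 x) := by
  have hfix : ∀ (τ : L ≃ₐ[Ft] L) (g : K[X]), τ (algebraMap K[X] L g) = algebraMap K[X] L g :=
    fun τ g => by rw [IsScalarTower.algebraMap_apply K[X] Ft L]; exact τ.commutes _
  have hK : ∀ (τ : L ≃ₐ[Ft] L) (c : K), τ (algebraMap K L c) = algebraMap K L c := fun τ c => by
    rw [IsScalarTower.algebraMap_apply K K[X] L]; exact hfix τ _
  let ψ : L →ₗ[K] L :=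
    { toFun := fun x => σ.symm (D0 (σ x))
      map_add' := fun x y => by simp
      map_smul' := fun c x => by
        rw [Algebra.smul_def, map_mul, hK, ← Algebra.smul_def, D0.map_smul, Algebra.smul_def, map_mul,
          hK, RingHom.id_apply, Algebra.smul_def] }
  let D1 : Derivation K L L := Derivation.mk' ψ fun a b => by
    change σ.symm (D0 (σ (a * b))) = a • σ.symm (D0 (σ b)) + b • σ.symm (D0 (σ a))
    simp
  have := pp_deriv_unique (Ft := Ft) D1 D0 fun g => by
    change σ.symm (D0 (σ (algebraMap K[X] L g))) = _
    rw [hfix, hD0, hfix]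
  have h2 : D1 x = D0 x := by rw [this]
  change σ.symm (D0 (σ x)) = D0 x at h2
  rw [← h2, AlgEquiv.apply_symm_apply]

theorem pp_const_Ft (D0 : Derivation K L L) (hD0 : ∀ g : K[X],
    D0 (algebraMap K[X] L g) = algebraMap K[X] L (derivative g)) (y : Ft)
    (hy : D0 (algebraMap Ft L y) = 0) : ∃ c : K, algebraMap Ft L y = algebraMap K L c := by
  have hinj : Function.Injective (algebraMap K[X] L) := by
    rw [IsScalarTower.algebraMap_eq K[X] Ft L]
    exact (algebraMap Ft L).injective.comp (IsFractionRing.injective K[X] Ft)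
  obtain ⟨a, b, hrel, hab⟩ := IsFractionRing.exists_reduced_fraction (A := K[X]) y
  have hb0 : (b : K[X]) ≠ 0 := nonZeroDivisors.coe_ne_zero b
  have h1 : algebraMap Ft L y * algebraMap K[X] L b = algebraMap K[X] L a := by
    rw [← hab, IsScalarTower.algebraMap_apply K[X] Ft L, ← map_mul, IsLocalization.mk'_spec,
      ← IsScalarTower.algebraMap_apply]
  have h2 := congrArg D0 h1
  rw [D0.leibniz, hy, smul_zero, add_zero, hD0, hD0, smul_eq_mul] at h2
  have h3 : a * derivative (b : K[X]) = b * derivative a := by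
    apply hinj
    rw [map_mul, map_mul, ← h1, ← h2]; ring
  have hdvd : (b : K[X]) ∣ derivative (b : K[X]) :=
    (hrel.symm).dvd_of_dvd_mul_left ⟨_, h3⟩
  have hb' : derivative (b : K[X]) = 0 := by
    by_contra hne
    have := degree_le_of_dvd hdvd hne
    exact absurd (degree_derivative_lt hb0) (not_lt.mpr this)
  have ha' : derivative a = 0 := by
    rw [hb', mul_zero] at h3
    rcases mul_eq_zero.mp h3.symm with h | h
    · exact absurd h hb0
    · exact h
  rw [derivative_eq_zero] at hb' ha'
  rw [natDegree_eq_zero] at hb' ha'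
  obtain ⟨cb, hcb⟩ := hb'
  obtain ⟨ca, hca⟩ := ha'
  have hcb0 : cb ≠ 0 := fun h => hb0 (by rw [← hcb, h, C_0])
  refine ⟨ca / cb, ?_⟩
  have hK : ∀ c : K, algebraMap K L c = algebraMap K[X] L (C c) := fun c => by
    rw [IsScalarTower.algebraMap_apply K K[X] L]; rfl
  rw [map_div₀, hK, hK, hcb, hca, eq_div_iff, h1]
  rw [Ne, map_eq_zero_iff _ hinj]
  exact hb0

theorem pp_const [IsGalois Ft L] (D0 : Derivation K L L) (hD0 : ∀ g : K[X],
    D0 (algebraMap K[X] L g) = algebraMap K[X] L (derivative g))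
    (halg : ∀ x : L, IsAlgebraic K x → x ∈ Set.range (algebraMap K L)) (x : L) (hx : D0 x = 0) :
    x ∈ Set.range (algebraMap K L) := by
  apply halg
  let S : Subring L :=
    { carrier := {x | D0 x = 0}
      mul_mem' := fun {a b} ha hb => by
        simp only [Set.mem_setOf_eq] at *
        simp [ha, hb]
      one_mem' := by simp
      add_mem' := fun {a b} ha hb => by
        simp only [Set.mem_setOf_eq] at *
        simp [ha, hb]
      zero_mem' := by simp
      neg_mem' := fun {a} ha => by
        simp only [Set.mem_setOf_eq] at *
        simp [ha] }
  have hS : ∀ y, y ∈ S ↔ D0 y = 0 := fun y => Iff.rfl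
  have hx2 : ∀ σ : L ≃ₐ[Ft] L, σ x ∈ S := fun σ => by
    rw [hS, pp_deriv_comm D0 hD0, hx, map_zero]
  have := Fintype.ofFinite (L ≃ₐ[Ft] L)
  set P : S[X] := ∏ σ : L ≃ₐ[Ft] L, (X - C ⟨σ x, hx2 σ⟩) with hP
  set Q : L[X] := P.map S.subtype with hQ
  have hQ2 : Q = ∏ σ : L ≃ₐ[Ft] L, (X - C (σ x)) := by
    rw [hQ, hP, Polynomial.map_prod]
    simp
  have hmon : Q.Monic := by
    rw [hQ2]; exact monic_prod_of_monic _ _ fun σ _ => monic_X_sub_C _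
  have hroot : Q.eval x = 0 := by
    rw [hQ2, eval_prod]
    exact Finset.prod_eq_zero (Finset.mem_univ (1 : L ≃ₐ[Ft] L)) (by simp)
  have hcoef : ∀ i, ∃ c : K, Q.coeff i = algebraMap K L c := fun i => by
    have h1 : Q.coeff i ∈ S := by rw [hQ, coeff_map]; exact (P.coeff i).2
    have h2 : Q.coeff i ∈ Set.range (algebraMap Ft L) := by
      rw [IsGalois.mem_range_algebraMap_iff_fixed]
      intro τ
      have h3 : Q.map (τ : L →+* L) = Q := by
        rw [hQ2, Polynomial.map_prod]
        simp only [Polynomial.map_sub, map_X, map_C]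
        exact Fintype.prod_equiv (Equiv.mulLeft τ) _ _ fun σ => by simp
      conv_rhs => rw [← h3]
      exact (coeff_map (p := Q) (τ : L →+* L) i).symm
    obtain ⟨y, hy⟩ := h2
    rw [← hy, hS] at h1
    rw [← hy]
    exact pp_const_Ft D0 hD0 y h1
  have hlift : Q ∈ Polynomial.lifts (algebraMap K L) := by
    rw [Polynomial.lifts_iff_coeff_lifts]
    intro i
    obtain ⟨c, hc⟩ := hcoef i
    exact ⟨c, hc.symm⟩
  obtain ⟨q, hq⟩ := hlift
  have hq : q.map (algebraMap K L) = Q := hq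
  refine ⟨q, fun h => hmon.ne_zero ?_, ?_⟩
  · rw [← hq, h, Polynomial.map_zero]
  · rw [← hroot, ← hq, eval_map, aeval_def]

end derivconstr

end part6

section part7

/-- The space of combinations of the `b j` with polynomial coefficients of degree at most `m`. -/
def ppU (K : Type*) {L κ : Type*} [Field K] [Field L] [Algebra K[X] L] [Algebra K L]
    (b : κ → L) (m : ℕ) : Submodule K L :=
  Submodule.span K (Set.range (fun ij : κ × Fin (m + 1) =>
    algebraMap K[X] L (X ^ (ij.2 : ℕ)) * b ij.1))

section ppU
variable {K L κ : Type*} [Field K] [Field L] [Algebra K[X] L] [Algebra K L]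
  [IsScalarTower K K[X] L] (b : κ → L)

theorem ppU_fin [Fintype κ] (m : ℕ) : FiniteDimensional K (ppU K b m) :=
  FiniteDimensional.span_of_finite K (Set.finite_range _)

theorem ppU_finrank [Fintype κ] (m : ℕ) :
    Module.finrank K (ppU K b m) ≤ Fintype.card κ * (m + 1) := by
  refine (finrank_range_le_card _).trans ?_
  simp

theorem ppU_mono {m n : ℕ} (h : m ≤ n) : ppU K b m ≤ ppU K b n := by
  refine Submodule.span_le.mpr ?_
  rintro _ ⟨⟨j, i⟩, rfl⟩
  exact Submodule.subset_span ⟨(j, ⟨i, by omega⟩), rfl⟩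

theorem ppU_X_mul {m : ℕ} (k : ℕ) {x : L} (hx : x ∈ ppU K b m) :
    algebraMap K[X] L (X ^ k) * x ∈ ppU K b (m + k) := by
  induction hx using Submodule.span_induction with
  | mem x hx =>
    obtain ⟨⟨j, i⟩, rfl⟩ := hx
    refine Submodule.subset_span ⟨(j, ⟨i + k, by omega⟩), ?_⟩
    simp only [pow_add, map_mul]; ring
  | zero => simp
  | add x y _ _ hx hy => rw [mul_add]; exact add_mem hx hy
  | smul a x _ hx => rw [mul_smul_comm]; exact Submodule.smul_mem _ _ hx

theorem ppU_mul {m : ℕ} (n : ℕ) (g : K[X]) (hg : g.natDegree ≤ n) {x : L} (hx : x ∈ ppU K b m) :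
    algebraMap K[X] L g * x ∈ ppU K b (m + n) := by
  rw [g.as_sum_range_C_mul_X_pow, map_sum, Finset.sum_mul]
  refine sum_mem fun i hi => ?_
  rw [Finset.mem_range] at hi
  rw [map_mul, mul_assoc]
  have : algebraMap K[X] L (C (g.coeff i)) = algebraMap K L (g.coeff i) :=
    (IsScalarTower.algebraMap_apply K K[X] L _).symm
  rw [this, ← Algebra.smul_def]
  exact Submodule.smul_mem _ _ (ppU_mono b (by omega) (ppU_X_mul b i hx))

theorem ppU_basis (j : κ) : b j ∈ ppU K b 0 := by
  refine Submodule.subset_span ⟨(j, 0), ?_⟩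
  simp

theorem ppU_D (D : Derivation K L L) (δ : K[X]) (hD : ∀ g : K[X],
    D (algebraMap K[X] L g) = algebraMap K[X] L (δ * derivative g)) (γ : ℕ) (hδ : δ.natDegree ≤ γ)
    (hb : ∀ j, D (b j) ∈ ppU K b γ) (m : ℕ) (x : L) (hx : x ∈ ppU K b m) :
    D x ∈ ppU K b (m + γ) := by
  induction hx using Submodule.span_induction with
  | mem x hx =>
    obtain ⟨⟨j, i⟩, rfl⟩ := hx
    rw [D.leibniz, hD]
    refine add_mem ?_ ?_
    · rw [smul_eq_mul]
      exact ppU_mono b (by omega) (ppU_X_mul b i (hb j))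
    · rw [smul_eq_mul, mul_comm]
      refine ppU_mono b (show 0 + (γ + m) ≤ _ by omega) (ppU_mul b _ _ ?_ (ppU_basis b j))
      refine natDegree_mul_le.trans (add_le_add hδ ?_)
      refine (natDegree_derivative_le _).trans ?_
      rw [natDegree_X_pow]; omega
  | zero => simp
  | add x y _ _ hx hy => rw [map_add]; exact add_mem hx hy
  | smul a x _ hx => rw [D.map_smul]; exact Submodule.smul_mem _ _ hx

theorem ppU_sig (σ : L →ₐ[K] L) (hσ : ∀ g : K[X], σ (algebraMap K[X] L g) = algebraMap K[X] L g)
    (η : L) (γ : ℕ) (hη : ∀ i j, η * (b i * σ (b j)) ∈ ppU K b γ) (m n : ℕ) (x y : L)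
    (hx : x ∈ ppU K b m) (hy : y ∈ ppU K b n) : η * (x * σ y) ∈ ppU K b (m + n + γ) := by
  induction hx using Submodule.span_induction with
  | mem x hx =>
    obtain ⟨⟨j, i⟩, rfl⟩ := hx
    induction hy using Submodule.span_induction with
    | mem y hy =>
      obtain ⟨⟨j', i'⟩, rfl⟩ := hy
      have : η * (algebraMap K[X] L (X ^ (i : ℕ)) * b j *
          σ (algebraMap K[X] L (X ^ (i' : ℕ)) * b j')) =
          algebraMap K[X] L (X ^ ((i : ℕ) + i')) * (η * (b j * σ (b j'))) := by
        rw [map_mul σ, hσ, pow_add, map_mul]; ring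
      simp only
      rw [this]
      exact ppU_mono b (by omega) (ppU_X_mul b _ (hη j j'))
    | zero => simp
    | add x y _ _ hx hy => rw [map_add, mul_add, mul_add]; exact add_mem hx hy
    | smul a x _ hx =>
      rw [map_smul, mul_smul_comm, mul_smul_comm]; exact Submodule.smul_mem _ _ hx
  | zero => simp
  | add x y _ _ hx hy => rw [add_mul, mul_add]; exact add_mem hx hy
  | smul a x _ hx =>
    rw [smul_mul_assoc, mul_smul_comm]; exact Submodule.smul_mem _ _ hx

theorem ppU_iter (D : Derivation K L L) (γ : ℕ) (hD : ∀ m, ∀ x ∈ ppU K b m, D x ∈ ppU K b (m + γ))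
    (m : ℕ) (x : L) (hx : x ∈ ppU K b m) (k : ℕ) : D^[k] x ∈ ppU K b (m + k * γ) := by
  induction k with
  | zero => simpa using hx
  | succ k ih =>
    rw [Function.iterate_succ_apply']
    have := hD _ _ ih
    rwa [show m + (k + 1) * γ = m + k * γ + γ by ring]

/-- the family `t^i b_j`, `i ≤ m`. -/
noncomputable def ppfam (K : Type*) {L κ : Type*} [Field K] [Field L] [Algebra K[X] L] (b : κ → L) (m : ℕ) :
    κ × Fin (m + 1) → L :=
  fun ij => algebraMap K[X] L (X ^ (ij.2 : ℕ)) * b ij.1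

theorem pp_aux_K [Fintype κ] (D : Derivation K L L) (γ : ℕ)
    (hD : ∀ m, ∀ x ∈ ppU K b m, D x ∈ ppU K b (m + γ)) (σ : L → L)
    (η : L) (hη : η ≠ 0)
    (hmul : ∀ m n x y, x ∈ ppU K b m → y ∈ ppU K b n → η * (x * σ y) ∈ ppU K b (m + n + γ))
    (A0 B' M : ℕ) (hdim : M * (Fintype.card κ * (A0 + B' + γ * (M + 1) + 1)) <
      (Fintype.card κ * (A0 + 1)) * (Fintype.card κ * (B' + 1))) :
    ∃ c : κ × Fin (A0 + 1) → κ × Fin (B' + 1) → K, c ≠ 0 ∧ ∀ k < M,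
      ∑ i, D^[k] (ppfam K b A0 i) * ∑ j, algebraMap K L (c i j) * σ (ppfam K b B' j) = 0 := by
  classical
  have := ppU_fin (K := K) b (A0 + B' + γ * (M + 1))
  have hmem : ∀ (k : Fin M) i j, η * (D^[(k : ℕ)] (ppfam K b A0 i) * σ (ppfam K b B' j)) ∈
      ppU K b (A0 + B' + γ * (M + 1)) := fun k i j => by
    have h1 : ppfam K b A0 i ∈ ppU K b A0 := Submodule.subset_span ⟨i, rfl⟩
    have h2 : ppfam K b B' j ∈ ppU K b B' := Submodule.subset_span ⟨j, rfl⟩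
    have h3 := hmul _ _ _ _ (ppU_iter b D γ hD _ _ h1 k) h2
    refine ppU_mono b ?_ h3
    have : (k : ℕ) * γ ≤ M * γ := Nat.mul_le_mul_right _ k.2.le
    nlinarith
  let Ψ : ((κ × Fin (A0 + 1)) × (κ × Fin (B' + 1)) → K) →ₗ[K]
      (Fin M → ppU K b (A0 + B' + γ * (M + 1))) :=
    LinearMap.pi fun k => Fintype.linearCombination K fun ij => ⟨_, hmem k ij.1 ij.2⟩
  have hlt : Module.finrank K (Fin M → ppU K b (A0 + B' + γ * (M + 1))) <
      Module.finrank K ((κ × Fin (A0 + 1)) × (κ × Fin (B' + 1)) → K) := by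
    rw [Module.finrank_pi_fintype, Module.finrank_pi]
    simp only [Finset.sum_const, Finset.card_univ, Fintype.card_fin, smul_eq_mul, Fintype.card_prod]
    refine lt_of_le_of_lt (Nat.mul_le_mul_left _ (ppU_finrank b _)) hdim
  obtain ⟨c, hc, hc0⟩ := Submodule.exists_mem_ne_zero_of_ne_bot (LinearMap.ker_ne_bot_of_finrank_lt (f := Ψ) hlt)
  refine ⟨fun i j => c (i, j), fun h => hc0 (funext fun ij => congrFun (congrFun h ij.1) ij.2), ?_⟩
  intro k hk
  have h1 := congrFun (LinearMap.mem_ker.mp hc) ⟨k, hk⟩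
  have h2 := congrArg Subtype.val h1
  simp only [Ψ, LinearMap.pi_apply, Fintype.linearCombination_apply, Submodule.coe_sum,
    Submodule.coe_smul, Pi.zero_apply, Submodule.coe_zero] at h2
  apply (mul_eq_zero.mp (?_ : η * _ = 0)).resolve_left hη
  rw [Fintype.sum_prod_type] at h2
  refine Eq.trans ?_ h2
  rw [Finset.mul_sum]
  refine Finset.sum_congr rfl fun i _ => ?_
  rw [Finset.mul_sum, Finset.mul_sum]
  refine Finset.sum_congr rfl fun j _ => ?_
  rw [Algebra.smul_def]; ring

theorem pp_aux_O {O : Type*} [CommRing O] [IsDomain O] [Algebra O K] [IsFractionRing O K] {ι ι' : Type*} [Fintype ι]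
    [Fintype ι'] (c : ι → ι' → K) (hc : c ≠ 0) : ∃ c' : ι → ι' → O, c' ≠ 0 ∧
      ∃ a : K, ∀ i j, algebraMap O K (c' i j) = a * c i j := by
  obtain ⟨a, ha⟩ := IsLocalization.exist_integer_multiples_of_finite (nonZeroDivisors O)
    (fun ij : ι × ι' => c ij.1 ij.2)
  choose c' hc' using ha
  have ha0 : algebraMap O K a ≠ 0 := by
    simp
  refine ⟨fun i j => c' (i, j), fun h => hc ?_, algebraMap O K a, fun i j => ?_⟩
  · funext i j
    have h1 := hc' (i, j)
    have h2 : c' (i, j) = 0 := congrFun (congrFun h i) j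
    rw [h2, map_zero, Algebra.smul_def] at h1
    exact (mul_eq_zero.mp h1.symm).resolve_left ha0
  · rw [hc', Algebra.smul_def]

end ppU

end part7

section part8

section p8
universe u
variable {O K Ft L : Type u} [Field K] [Field Ft] [Field L] [CharZero K] [Algebra K[X] Ft]
  [IsFractionRing K[X] Ft] [Algebra Ft L] [Algebra K[X] L] [IsScalarTower K[X] Ft L] [Algebra K L]
  [IsScalarTower K K[X] L] [FiniteDimensional Ft L]
  [CommRing O] [IsDomain O] [Algebra O K] [IsFractionRing O K] [Algebra O[X] Ft]
  [IsFractionRing O[X] Ft] [Algebra O[X] L] [IsScalarTower O[X] Ft L]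
  {κ : Type u} [Fintype κ]

theorem pp_inj (K Ft L : Type*) [Field K] [Field Ft] [Field L] [Algebra K[X] Ft]
    [IsFractionRing K[X] Ft] [Algebra Ft L] [Algebra K[X] L] [IsScalarTower K[X] Ft L] :
    Function.Injective (algebraMap K[X] L) := by
  rw [IsScalarTower.algebraMap_eq K[X] Ft L]
  exact (algebraMap Ft L).injective.comp (IsFractionRing.injective K[X] Ft)

theorem pp_injO (O Ft L : Type*) [CommRing O] [Field Ft] [Field L] [Algebra O[X] Ft]
    [IsFractionRing O[X] Ft] [Algebra Ft L] [Algebra O[X] L] [IsScalarTower O[X] Ft L] :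
    Function.Injective (algebraMap O[X] L) := by
  rw [IsScalarTower.algebraMap_eq O[X] Ft L]
  exact (algebraMap Ft L).injective.comp (IsFractionRing.injective O[X] Ft)

theorem pp_indep (b : Module.Basis κ Ft L) (m : ℕ) (c : κ × Fin (m + 1) → K)
    (hc : ∑ ij, algebraMap K L (c ij) * ppfam K b m ij = 0) : c = 0 := by
  have h1 : ∑ j, algebraMap K[X] Ft (∑ i : Fin (m + 1), C (c (j, i)) * X ^ (i : ℕ)) • b j = 0 := by
    rw [← hc, Fintype.sum_prod_type]
    refine Finset.sum_congr rfl fun j _ => ?_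
    rw [Algebra.smul_def, ← IsScalarTower.algebraMap_apply, map_sum, Finset.sum_mul]
    refine Finset.sum_congr rfl fun i _ => ?_
    rw [ppfam, map_mul, IsScalarTower.algebraMap_apply K K[X] L, mul_assoc]
    rfl
  have h2 := Fintype.linearIndependent_iff.mp b.linearIndependent _ h1
  funext ⟨j, i⟩
  have h3 := h2 j
  rw [map_eq_zero_iff _ (IsFractionRing.injective K[X] Ft)] at h3
  have h4 := congrArg (fun p => coeff p i) h3
  simp only [finsetSum_coeff, coeff_C_mul, coeff_X_pow, coeff_zero] at h4
  rw [Finset.sum_eq_single i] at h4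
  · simpa using h4
  · intro i' _ hne
    rw [if_neg, mul_zero]
    intro h; exact hne (Fin.ext h.symm)
  · simp

theorem pp_mem_U (b : Module.Basis κ Ft L) (x : L)
    (hx : ∀ j, ∃ a : K[X], b.repr x j = algebraMap K[X] Ft a) : ∃ γ, x ∈ ppU K b γ := by
  choose a ha using hx
  refine ⟨Finset.univ.sup (fun j => (a j).natDegree), ?_⟩
  rw [← b.sum_repr x]
  refine sum_mem fun j _ => ?_
  rw [ha, Algebra.smul_def, ← IsScalarTower.algebraMap_apply]
  have := ppU_mul (K := K) b (Finset.univ.sup (fun j => (a j).natDegree)) (a j)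
    (Finset.le_sup (f := fun j => (a j).natDegree) (Finset.mem_univ j)) (ppU_basis b j)
  rwa [zero_add] at this

include Ft in
theorem pp_denom 
    (hcompat : ∀ g : O[X], algebraMap O[X] L g = algebraMap K[X] L (g.map (algebraMap O K)))
    (b : Module.Basis κ Ft L) (s : Finset L) : ∃ g : O[X], g ≠ 0 ∧ ∃ γ, ∀ x ∈ s,
      algebraMap O[X] L g * x ∈ ppU K b γ := by
  classical
  have hcompat2 : ∀ g : O[X], algebraMap O[X] Ft g = algebraMap K[X] Ft (g.map (algebraMap O K)) := by
    intro g
    apply (algebraMap Ft L).injective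
    rw [← IsScalarTower.algebraMap_apply, ← IsScalarTower.algebraMap_apply, hcompat]
  obtain ⟨g, hg⟩ := IsLocalization.exist_integer_multiples_of_finite (nonZeroDivisors O[X])
    (fun xj : s × κ => b.repr xj.1 xj.2)
  have h1 : ∀ x : s, ∃ γ, algebraMap O[X] L g * x ∈ ppU K b γ := fun x => by
    refine pp_mem_U b _ fun j => ?_
    obtain ⟨a, ha⟩ := hg (x, j)
    refine ⟨a.map (algebraMap O K), ?_⟩
    rw [← hcompat2, ha, IsScalarTower.algebraMap_apply O[X] Ft L, ← Algebra.smul_def, map_smul,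
      Finsupp.smul_apply, smul_eq_mul]
    exact (Algebra.smul_def _ _).symm
  choose γ hγ using h1
  refine ⟨g, nonZeroDivisors.coe_ne_zero g, Finset.univ.sup γ, fun x hx => ?_⟩
  exact ppU_mono b (Finset.le_sup (f := γ) (Finset.mem_univ (⟨x, hx⟩ : s))) (hγ ⟨x, hx⟩)

include Ft in
theorem pp_intmul (s : Finset L) : ∃ g : O[X], g ≠ 0 ∧ ∀ x ∈ s, IsIntegral O[X] (algebraMap O[X] L g * x) := by
  obtain ⟨y, hy, h⟩ := exists_integral_multiples O[X] Ft s
  exact ⟨y, hy, fun x hx => by rw [← Algebra.smul_def]; exact h x hx⟩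

include Ft in
theorem pp_exists_D (B : Type*) [CommRing B] [Algebra O[X] B] [Algebra B L]
    [IsScalarTower O[X] B L] [IsIntegralClosure B O[X] L] [Module.Finite O[X] B]
    (hcompat : ∀ g : O[X], algebraMap O[X] L g = algebraMap K[X] L (g.map (algebraMap O K)))
    (b : Module.Basis κ Ft L) (D0 : Derivation K L L) (hD0 : ∀ g : K[X],
    D0 (algebraMap K[X] L g) = algebraMap K[X] L (derivative g)) :
    ∃ δ : O[X], δ ≠ 0 ∧ (∃ DB : Derivation ℤ B B,
      ∀ x, algebraMap B L (DB x) = algebraMap O[X] L δ * D0 (algebraMap B L x)) ∧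
      ∃ γ, δ.natDegree ≤ γ ∧ ∀ j, algebraMap O[X] L δ * D0 (b j) ∈ ppU K b γ := by
  classical
  have hinjB := IsIntegralClosure.algebraMap_injective B O[X] L
  obtain ⟨s, hs⟩ := Module.Finite.fg_top (R := O[X]) (M := B)
  obtain ⟨δ1, hδ1, h1⟩ := pp_intmul (O := O) (Ft := Ft) (s.image fun x => D0 (algebraMap B L x))
  obtain ⟨δ2, hδ2, γ, h2⟩ := pp_denom hcompat b (Finset.univ.image fun j => D0 (b j))
  have hIntegral : ∀ x : B, IsIntegral O[X] (algebraMap O[X] L (δ1 * δ2) * D0 (algebraMap B L x)) := by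
    intro x
    have hx : x ∈ Submodule.span O[X] (s : Set B) := by rw [hs]; trivial
    induction hx using Submodule.span_induction with
    | mem x hx =>
      rw [mul_comm δ1, map_mul, mul_assoc]
      exact isIntegral_algebraMap.mul (h1 _ (Finset.mem_image.mpr ⟨x, hx, rfl⟩))
    | zero => simp [isIntegral_zero]
    | add x y _ _ hx hy => rw [map_add, map_add, mul_add]; exact hx.add hy
    | smul a x _ hx =>
      rw [Algebra.smul_def, map_mul (algebraMap B L), ← IsScalarTower.algebraMap_apply, D0.leibniz, hcompat a, hD0,
        derivative_map, ← hcompat, ← hcompat, smul_eq_mul, smul_eq_mul, mul_add]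
      refine IsIntegral.add ?_ ?_
      · rw [mul_left_comm]
        exact isIntegral_algebraMap.mul hx
      · exact isIntegral_algebraMap.mul ((IsIntegralClosure.isIntegral O[X] L x).algebraMap.mul
          isIntegral_algebraMap)
  choose d hd using fun x => (IsIntegralClosure.isIntegral_iff (A := B)).mp (hIntegral x)
  let DB : Derivation ℤ B B := Derivation.mk' (AddMonoidHom.toIntLinearMap
    { toFun := d
      map_zero' := hinjB (by rw [hd]; simp)
      map_add' := fun x y => hinjB (by
        rw [hd, map_add, map_add, map_add, hd, hd, mul_add]) })
    fun x y => hinjB (by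
      change algebraMap B L (d (x * y)) = algebraMap B L (x * d y + y * d x)
      rw [hd, map_mul (algebraMap B L), D0.leibniz, map_add, map_mul (algebraMap B L),
        map_mul (algebraMap B L), hd, hd, smul_eq_mul, smul_eq_mul]
      ring)
  refine ⟨δ1 * δ2, mul_ne_zero hδ1 hδ2, ⟨DB, fun x => hd x⟩, 
    γ + δ1.natDegree + (δ1 * δ2).natDegree, by omega, fun j => ?_⟩
  rw [map_mul, mul_assoc, hcompat δ1]
  refine ppU_mono b (by omega) (ppU_mul b _ _ natDegree_map_le (h2 _ ?_))
  exact Finset.mem_image.mpr ⟨j, Finset.mem_univ _, rfl⟩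

end p8

end part8

section part9

section p9a
variable {O B G : Type*} [CommRing O] [IsDomain O] [CommRing B] [IsDomain B] [Algebra O[X] B]
  [Group G] [Finite G] [MulSemiringAction G B] [Algebra.IsInvariant O[X] B G]

variable (O G) in
include G in
theorem pp_dvd (b : B) : ∃ a : O[X], a ≠ 0 ∧ (b ≠ 0 → b ∣ algebraMap O[X] B a) := by
  by_cases hb : b = 0
  · exact ⟨1, one_ne_zero, fun h => absurd hb h⟩
  have := Fintype.ofFinite G
  obtain ⟨a, ha⟩ := Algebra.IsInvariant.isInvariant (A := O[X]) (G := G) (∏ g : G, g • b)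
    (fun g => by
      rw [Finset.smul_prod']
      exact Fintype.prod_equiv (Equiv.mulLeft g) _ _ fun σ => by simp [mul_smul])
  refine ⟨a, fun h => ?_, fun _ => ?_⟩
  · rw [h, map_zero, eq_comm, Finset.prod_eq_zero_iff] at ha
    obtain ⟨g, _, hg⟩ := ha
    exact hb ((smul_eq_zero_iff_eq g).mp hg)
  · rw [ha]
    have := Finset.dvd_prod_of_mem (fun g : G => g • b) (Finset.mem_univ 1)
    simpa using this

variable (O G) in
include G in
theorem pp_avoid (b : B) (hb : b ≠ 0) : ∃ g : O, g ≠ 0 ∧ ∀ p : Ideal O, g ∉ p → ∀ P : Ideal B,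
    P.under O[X] = p.map (C : O →+* O[X]) → b ∉ P := by
  obtain ⟨a, ha0, ha⟩ := pp_dvd O G b
  refine ⟨a.leadingCoeff, leadingCoeff_ne_zero.mpr ha0, fun p hp P hP hbP => hp ?_⟩
  obtain ⟨y, hy⟩ := ha hb
  have h1 : a ∈ P.under O[X] := by
    change algebraMap O[X] B a ∈ P
    rw [hy]; exact P.mul_mem_right _ hbP
  rw [hP, Ideal.mem_map_C_iff] at h1
  exact h1 _

variable (O) in
theorem pp_theta (Z : Multiset B) : ∃ θ : O[X], θ ≠ 0 ∧ ∀ σ : G, ∀ z ∈ Z, σ • z ≠ z →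
    (σ • z - z) ∣ algebraMap O[X] B θ := by
  classical
  have := Fintype.ofFinite G
  choose a ha0 ha using pp_dvd (B := B) O G
  refine ⟨∏ σ : G, ∏ z ∈ Z.toFinset, a (σ • z - z), ?_, fun σ z hz hne => ?_⟩
  · exact Finset.prod_ne_zero_iff.mpr fun σ _ => Finset.prod_ne_zero_iff.mpr fun z _ => ha0 _
  · refine (ha _ (sub_ne_zero.mpr hne)).trans (map_dvd _ ?_)
    refine Dvd.dvd.trans ?_ (Finset.dvd_prod_of_mem (fun σ : G => ∏ z ∈ Z.toFinset, a (σ • z - z))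
      (Finset.mem_univ σ))
    exact Finset.dvd_prod_of_mem (fun z => a (σ • z - z)) (Multiset.mem_toFinset.mpr hz)
end p9a

theorem pp_zeros {O : Type*} [CommRing O] (p : Ideal O) [p.IsMaximal] [Finite (O ⧸ p)] (g : O[X])
    (hg : g.leadingCoeff ∉ p) : {a : O ⧸ p | ppev p a g = 0}.ncard ≤ g.natDegree := by
  classical
  letI := Ideal.Quotient.field p
  set h := g.map (Ideal.Quotient.mk p) with hh
  have h0 : h ≠ 0 := by
    intro h1
    apply hg
    rw [← Ideal.Quotient.eq_zero_iff_mem]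
    have := congrArg (fun r => coeff r g.natDegree) h1
    simpa [hh] using this
  calc _ ≤ (h.roots.toFinset : Set (O ⧸ p)).ncard := by
        refine Set.ncard_le_ncard (fun a ha => ?_) (Finset.finite_toSet _)
        simp only [Finset.mem_coe, Multiset.mem_toFinset, mem_roots h0, IsRoot.def]
        rw [hh, eval_map]; exact ha
    _ = h.roots.toFinset.card := Set.ncard_coe_finset _
    _ ≤ _ := (Multiset.toFinset_card_le _).trans ((card_roots' h).trans natDegree_map_le)

section p9b
universe u
variable {O K Ft L : Type u} [Field K] [Field Ft] [Field L] [CharZero K] [Algebra K[X] Ft]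
  [IsFractionRing K[X] Ft] [Algebra Ft L] [Algebra K[X] L] [IsScalarTower K[X] Ft L] [Algebra K L]
  [IsScalarTower K K[X] L] [FiniteDimensional Ft L] [IsGalois Ft L]
  [CommRing O] [IsDomain O] [Algebra O K] [IsFractionRing O K] [Algebra O[X] Ft]
  [IsFractionRing O[X] Ft] [Algebra O[X] L] [IsScalarTower O[X] Ft L] [CharZero O]

set_option maxHeartbeats 1000000 in
theorem pp_main (B : Type u) [CommRing B] [IsDomain B] [Algebra O[X] B] [Algebra B L]
    [IsScalarTower O[X] B L] [IsIntegralClosure B O[X] L] [Module.Finite O[X] B]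
    [FaithfulSMul O[X] B]
    [MulSemiringAction (L ≃ₐ[Ft] L) B] [SMulCommClass (L ≃ₐ[Ft] L) O[X] B]
    [Algebra.IsInvariant O[X] B (L ≃ₐ[Ft] L)]
    (hsm : ∀ (σ : L ≃ₐ[Ft] L) (x : B), algebraMap B L (σ • x) = σ (algebraMap B L x))
    (hcompat : ∀ g : O[X], algebraMap O[X] L g = algebraMap K[X] L (g.map (algebraMap O K)))
    (halg : ∀ x : L, IsAlgebraic K x → x ∈ Set.range (algebraMap K L))
    (lc : O) (F : O[X]) (e0 : ℕ) (Z : Multiset B)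
    (hZ : ∀ u : O, (Z.map (fun z => ppc B (lc * u) - z)).prod =
      ppc B (lc ^ e0) * (ppc B (F.eval u) - algebraMap O[X] B X))
    (T : Finset (L ≃ₐ[Ft] L)) (hT : ∀ σ ∈ T, ∀ τ : L ≃ₐ[Ft] L, τ⁻¹ * σ * τ ∈ T)
    (hT2 : ∀ σ : L ≃ₐ[Ft] L, (∃ z ∈ Z, σ • z = z) → σ ∈ T) :
    ∃ g0 : O, g0 ≠ 0 ∧ ∃ Cst : ℕ, ∀ p : Ideal O, p.IsMaximal → Finite (O ⧸ p) → g0 ∉ p →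
      Nat.card (L ≃ₐ[Ft] L) *
        (Set.range (fun c : O ⧸ p => (F.map (Ideal.Quotient.mk p)).eval c)).ncard ≤
      3 * T.card * Nat.card (O ⧸ p) + Cst := by
  classical
  have hfinG : Fintype (L ≃ₐ[Ft] L) := Fintype.ofFinite _
  have hinjB := IsIntegralClosure.algebraMap_injective B O[X] L
  have hinjK := pp_inj K Ft L
  have hOK : Function.Injective (algebraMap O K) := IsFractionRing.injective O K
  have hinjO := pp_injO O Ft L
  have hfix : ∀ (τ : L ≃ₐ[Ft] L) (g : K[X]), τ (algebraMap K[X] L g) = algebraMap K[X] L g :=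
    fun τ g => by rw [IsScalarTower.algebraMap_apply K[X] Ft L]; exact τ.commutes _
  have hKC : ∀ c : K, algebraMap K[X] L (C c) = algebraMap K L c := fun c =>
    (IsScalarTower.algebraMap_apply K K[X] L c).symm
  have hppc : ∀ x : O, algebraMap B L (ppc B x) = algebraMap K L (algebraMap O K x) := fun x => by
    rw [ppc, RingHom.comp_apply, ← IsScalarTower.algebraMap_apply, hcompat, map_C, hKC]
  obtain ⟨D0, hD0⟩ := pp_deriv K Ft L
  obtain ⟨s, b, hb⟩ := FiniteDimensional.exists_is_basis_integral O[X] Ft L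
  have hcard : Fintype.card s = Nat.card (L ≃ₐ[Ft] L) := by
    rw [IsGalois.card_aut_eq_finrank, Module.finrank_eq_card_basis b]
  obtain ⟨δ, hδ0, ⟨DB, hDB⟩, γ1, hγ1, hDbound⟩ := pp_exists_D B hcompat b D0 hD0
  set D : Derivation K L L := (algebraMap O[X] L δ) • D0 with hDdef
  have hDap : ∀ x, D x = algebraMap O[X] L δ * D0 x := fun x => rfl
  have hδL : algebraMap O[X] L δ ≠ 0 := by rwa [Ne, map_eq_zero_iff _ hinjO]
  have hDit : ∀ k x, algebraMap B L (DB^[k] x) = D^[k] (algebraMap B L x) := fun k => by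
    induction k with
    | zero => intro x; rfl
    | succ k ih =>
      intro x
      rw [Function.iterate_succ_apply', Function.iterate_succ_apply', hDB, ih, hDap]
  have hDg : ∀ g : K[X], D (algebraMap K[X] L g) =
      algebraMap K[X] L (δ.map (algebraMap O K) * derivative g) := fun g => by
    rw [hDap, hD0, hcompat, map_mul]
  have hDBg : ∀ g : O[X], DB (algebraMap O[X] B g) = algebraMap O[X] B (δ * derivative g) := by
    intro g
    apply hinjB
    rw [hDB, ← IsScalarTower.algebraMap_apply, ← IsScalarTower.algebraMap_apply, hcompat g, hD0,
      derivative_map, ← hcompat, map_mul]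
  have hDBcomm : ∀ (g : L ≃ₐ[Ft] L) (x : B), DB (g • x) = g • DB x := by
    intro g x
    apply hinjB
    rw [hsm, hDB, hDB, hsm, pp_deriv_comm D0 hD0, map_mul, hcompat, hfix]
  have hDU : ∀ m, ∀ x ∈ ppU K b m, D x ∈ ppU K b (m + γ1) :=
    ppU_D b D (δ.map (algebraMap O K)) hDg γ1 (natDegree_map_le.trans hγ1) hDbound
  -- multiplication table
  obtain ⟨η, hη0, γ2, hη⟩ := pp_denom (K := K) hcompat b
    (Finset.univ.image fun x : (L ≃ₐ[Ft] L) × s × s => b x.2.1 * x.1 (b x.2.2))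
  have hηL : algebraMap O[X] L η ≠ 0 := by rwa [Ne, map_eq_zero_iff _ hinjO]
  have hmul : ∀ (σ : L ≃ₐ[Ft] L) m n x y, x ∈ ppU K b m → y ∈ ppU K b n →
      algebraMap O[X] L η * (x * σ y) ∈ ppU K b (m + n + γ2) := fun σ m n x y hx hy => by
    let σK : L →ₐ[K] L := { (σ : L →+* L) with
      commutes' := fun c => by
        change σ (algebraMap K L c) = _
        rw [← hKC, hfix] }
    exact ppU_sig b σK (hfix σ) _ γ2 (fun i j => hη _ (Finset.mem_image.mpr
      ⟨(σ, i, j), Finset.mem_univ _, rfl⟩)) m n x y hx hy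
  set γ := max γ1 γ2 with hγ
  have hDU2 : ∀ m, ∀ x ∈ ppU K b m, D x ∈ ppU K b (m + γ) := fun m x hx =>
    ppU_mono (K := K) b (by omega) (hDU m x hx)
  have hmul2 : ∀ (σ : L ≃ₐ[Ft] L) m n x y, x ∈ ppU K b m → y ∈ ppU K b n →
      algebraMap O[X] L η * (x * σ y) ∈ ppU K b (m + n + γ) := fun σ m n x y hx hy =>
    ppU_mono (K := K) b (by omega) (hmul σ m n x y hx hy)
  -- valuation
  obtain ⟨W, hW1, hW2⟩ := pp_val hinjK
  have hγ' : ∀ (τ : L ≃ₐ[Ft] L) (j : s), ∃ γ' : ℕ,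
      W.valuation (τ (b j)) ≤ W.valuation (algebraMap K[X] L X) ^ γ' := fun τ j => by
    refine pp_val_int W.valuation hW1 hW2 _ ?_
    refine (hb j).map_of_comp_eq (mapRingHom (algebraMap O K)) (τ : L →+* L) ?_
    refine RingHom.ext fun g => ?_
    change algebraMap K[X] L (g.map (algebraMap O K)) = τ (algebraMap O[X] L g)
    rw [hcompat, hfix]
  choose γ0 hγ0 using hγ'
  set γ' := Finset.univ.sup (fun x : (L ≃ₐ[Ft] L) × s => γ0 x.1 x.2) with hγ'def
  have hγ' : ∀ (τ : L ≃ₐ[Ft] L) (j : s),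
      W.valuation (τ (b j)) ≤ W.valuation (algebraMap K[X] L X) ^ γ' := fun τ j =>
    (hγ0 τ j).trans (pow_le_pow_right₀ hW1.le
      (Finset.le_sup (f := fun x : (L ≃ₐ[Ft] L) × s => γ0 x.1 x.2) (Finset.mem_univ (τ, j))))
  -- parameters
  set e := Nat.card (L ≃ₐ[Ft] L) with he
  have hepos : 0 < e := Nat.card_pos
  set M := e * (γ' + 1) with hM
  set B' := 2 * γ' + 1 with hB'
  set A0 := 2 * (γ' + 1) + γ * (M + 1) with hA0
  have hdim : M * (Fintype.card s * (A0 + B' + γ * (M + 1) + 1)) <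
      (Fintype.card s * (A0 + 1)) * (Fintype.card s * (B' + 1)) := by
    rw [hcard]
    have h1 : A0 + B' + γ * (M + 1) + 1 = 2 * A0 := by rw [hA0, hB']; ring
    have h2 : B' + 1 = 2 * (γ' + 1) := by rw [hB']; ring
    rw [h1, h2]
    have h3 : (e * (A0 + 1)) * (e * (2 * (γ' + 1))) = M * (e * (2 * A0)) + 2 * e * M := by
      rw [hM]; ring
    rw [h3]
    have : 0 < 2 * e * M := by rw [hM]; positivity
    omega
  have hc : ∀ σ : L ≃ₐ[Ft] L, ∃ c : s × Fin (A0 + 1) → s × Fin (B' + 1) → O, c ≠ 0 ∧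
      ∀ k < M, ∑ i, D^[k] (ppfam K b A0 i) *
        ∑ j, algebraMap K L (algebraMap O K (c i j)) * σ (ppfam K b B' j) = 0 := fun σ => by
    obtain ⟨c, hc0, hc⟩ := pp_aux_K (K := K) b D γ hDU2 σ _ hηL (hmul2 σ) A0 B' M hdim
    obtain ⟨c', hc'0, a, ha⟩ := pp_aux_O (O := O) c hc0
    refine ⟨c', hc'0, fun k hk => ?_⟩
    have h1 := hc k hk
    calc _ = algebraMap K L a * ∑ i, D^[k] (ppfam K b A0 i) *
        ∑ j, algebraMap K L (c i j) * σ (ppfam K b B' j) := by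
          rw [Finset.mul_sum]
          refine Finset.sum_congr rfl fun i _ => ?_
          rw [mul_left_comm]
          congr 1
          rw [Finset.mul_sum]
          refine Finset.sum_congr rfl fun j _ => ?_
          rw [ha, map_mul, mul_assoc]
      _ = 0 := by rw [h1, mul_zero]
  choose c hc0 hc using hc
  -- lift to B
  have hbB : ∀ j, ∃ x : B, algebraMap B L x = b j := fun j =>
    (IsIntegralClosure.isIntegral_iff (A := B)).mp (hb j)
  choose bB hbB using hbB
  set fam : ∀ m : ℕ, s × Fin (m + 1) → B := fun m ij =>
    algebraMap O[X] B (X ^ (ij.2 : ℕ)) * bB ij.1 with hfam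
  have hfamL : ∀ m ij, algebraMap B L (fam m ij) = ppfam K b m ij := fun m ij => by
    rw [hfam, ppfam]
    simp only
    rw [map_mul, hbB, ← IsScalarTower.algebraMap_apply, hcompat, Polynomial.map_pow, map_X]
  have haux : ∀ σ : L ≃ₐ[Ft] L, ∀ k < M,
      ∑ i, DB^[k] (fam A0 i) * ∑ j, ppc B (c σ i j) * σ • fam B' j = 0 := fun σ k hk => by
    apply hinjB
    rw [map_zero, ← hc σ k hk, map_sum]
    refine Finset.sum_congr rfl fun i _ => ?_
    rw [map_mul, hDit, hfamL, map_sum]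
    congr 1
    refine Finset.sum_congr rfl fun j _ => ?_
    rw [map_mul, hppc, hsm, hfamL]
  -- Wronskian
  obtain ⟨r, E, hE⟩ := pp_wronskian D (ppfam K b A0) (fun a ha hsum => by
    have h1 : ∀ i, ∃ x : K, algebraMap K L x = a i := fun i => by
      have h2 := ha i
      rw [hDap, mul_eq_zero] at h2
      exact pp_const (Ft := Ft) D0 hD0 halg _ (h2.resolve_left hδL)
    choose x hx using h1
    simp only [← hx] at hsum
    have := pp_indep b A0 x hsum
    funext i
    rw [← hx, this]; simp)
  obtain ⟨ω, hω0, hω⟩ := pp_intmul (O := O) (Ft := Ft)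
    ((Finset.univ ×ˢ Finset.range r).image fun x : (s × Fin (A0 + 1)) × ℕ => E x.1 x.2)
  have hEB : ∀ i k, ∃ x : B, k < r → algebraMap B L x = algebraMap O[X] L ω * E i k := fun i k => by
    by_cases hk : k < r
    · obtain ⟨x, hx⟩ := (IsIntegralClosure.isIntegral_iff (A := B)).mp
        (hω (E i k) (Finset.mem_image.mpr ⟨(i, k), by simpa using hk, rfl⟩))
      exact ⟨x, fun _ => hx⟩
    · exact ⟨0, fun h => absurd h hk⟩
  choose EB hEB using hEB
  have hEB2 : ∀ i j, ∑ k ∈ Finset.range r, EB i k * DB^[k] (fam A0 j) =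
      if i = j then algebraMap O[X] B ω else 0 := fun i j => by
    apply hinjB
    have h1 := congrArg (fun x => algebraMap O[X] L ω * x) (hE i j)
    simp only [Finset.mul_sum] at h1
    rw [map_sum]
    calc _ = ∑ k ∈ Finset.range r, algebraMap O[X] L ω * (E i k * D^[k] (ppfam K b A0 j)) := by
          refine Finset.sum_congr rfl fun k hk => ?_
          rw [map_mul, hDit, hfamL, hEB i k (Finset.mem_range.mp hk), mul_assoc]
      _ = _ := by
          rw [h1]
          split_ifs
          · rw [mul_one, ← IsScalarTower.algebraMap_apply]
          · simp
  -- nonvanishing elements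
  have hx : ∀ σ : L ≃ₐ[Ft] L, ∃ i, ∑ j, ppc B (c σ i j) * fam B' j ≠ 0 := fun σ => by
    by_contra hall
    push Not at hall
    apply hc0 σ
    funext i
    have h1 := congrArg (algebraMap B L) (hall i)
    rw [map_sum, map_zero] at h1
    have h2 := pp_indep b B' (fun j => algebraMap O K (c σ i j)) (by
      rw [← h1]
      refine Finset.sum_congr rfl fun j _ => ?_
      rw [map_mul, hppc, hfamL])
    funext j
    apply hOK
    rw [congrFun h2 j]; simp
  choose ix hix using hx
  have hωB : algebraMap O[X] B ω ≠ 0 := by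
    intro h
    apply hω0
    apply hinjO
    rw [IsScalarTower.algebraMap_apply O[X] B L, h, map_zero, map_zero]
  obtain ⟨g1, hg10, hg1⟩ := pp_avoid O (L ≃ₐ[Ft] L)
    (algebraMap O[X] B ω * ∏ σ, ∑ j, ppc B (c σ (ix σ) j) * fam B' j)
    (mul_ne_zero hωB (Finset.prod_ne_zero_iff.mpr fun σ _ => hix σ))
  obtain ⟨θ, hθ0, hθ⟩ := pp_theta (G := L ≃ₐ[Ft] L) O Z
  set g0 : O := g1 * ((M * e).factorial : O) * (e.factorial : O) * (δ * θ).leadingCoeff with hg0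
  refine ⟨g0, ?_, T.card * (A0 + γ') + e * (δ * θ).natDegree, ?_⟩
  · refine mul_ne_zero (mul_ne_zero (mul_ne_zero hg10 ?_) ?_) ?_
    · exact_mod_cast Nat.factorial_ne_zero _
    · exact_mod_cast Nat.factorial_ne_zero _
    · exact leadingCoeff_ne_zero.mpr (mul_ne_zero hδ0 hθ0)
  intro p hpmax hpfin hp
  have hp1 : g1 ∉ p := fun h => hp (by
    rw [hg0]; exact p.mul_mem_right _ (p.mul_mem_right _ (p.mul_mem_right _ h)))
  have hp2 : ((M * e).factorial : O) ∉ p := fun h => hp (by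
    rw [hg0]; exact p.mul_mem_right _ (p.mul_mem_right _ (p.mul_mem_left _ h)))
  have hp3 : (e.factorial : O) ∉ p := fun h => hp (by
    rw [hg0]; exact p.mul_mem_right _ (p.mul_mem_left _ h))
  have hp4 : (δ * θ).leadingCoeff ∉ p := fun h => hp (by
    rw [hg0]; exact p.mul_mem_left _ h)
  letI := Ideal.Quotient.field p
  have hfq : Fintype (O ⧸ p) := Fintype.ofFinite _
  set q := Nat.card (O ⧸ p) with hq
  obtain ⟨ℓ, hℓchar⟩ := CharP.exists (O ⧸ p)
  obtain ⟨n, hℓ, hqn⟩ := FiniteField.card (O ⧸ p) ℓ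
  have hqn' : q = ℓ ^ (n : ℕ) := by rw [hq, Nat.card_eq_fintype_card, hqn]
  have hℓp : (ℓ : O) ∈ p := by
    rw [← Ideal.Quotient.eq_zero_iff_mem, map_natCast]
    exact CharP.cast_eq_zero _ _
  have hqp : (q : O) ∈ p := by
    rw [hqn', Nat.cast_pow]; exact Ideal.pow_mem_of_mem _ hℓp _ n.pos
  have hfr : ∀ u : O, u ^ q - u ∈ p := fun u => by
    rw [← Ideal.Quotient.eq_zero_iff_mem, map_sub, map_pow, hq, Nat.card_eq_fintype_card,
      FiniteField.pow_card, sub_self]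
  have hgood : ∀ P : Ideal B, P.IsPrime → P.under O[X] = p.map (C : O →+* O[X]) →
      ∀ σ, ppPhi (c σ) (fam A0) (fam B') q ∉ P := fun P hPp hP σ => by
    have h1 := hg1 p hp1 P hP
    refine pp_nonvan (G := L ≃ₐ[Ft] L) DB δ hDBg p ℓ n q hℓ hqn' n.pos.ne' hℓp hfr (c σ) (fam A0) (fam B') r
      (algebraMap O[X] B ω) EB hEB2 P hP hp3 (fun h => h1 (P.mul_mem_right _ h))
      ⟨ix σ, fun h => h1 (P.mul_mem_left _ ?_)⟩
    exact P.mem_of_dvd (Finset.dvd_prod_of_mem (fun σ => ∑ j, ppc B (c σ (ix σ) j) * fam B' j)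
      (Finset.mem_univ σ)) h
  have hVfam : ∀ m (τ : L ≃ₐ[Ft] L) i, W.valuation (algebraMap B L (τ • fam m i)) ≤
      W.valuation (algebraMap K[X] L X) ^ (m + γ') := fun m τ i => by
    rw [hsm, hfamL, ppfam, map_mul, hfix, map_mul, pow_add]
    refine mul_le_mul' ?_ (hγ' _ _)
    exact pp_val_le W.valuation hW1 hW2 _ _ (by rw [natDegree_X_pow]; omega)
  set I : Set (O ⧸ p) := Set.range (fun c : O ⧸ p => (F.map (Ideal.Quotient.mk p)).eval c) with hI
  set Im : Finset (O ⧸ p) := Finset.univ.filter (fun a => a ∈ I ∧ ppev p a (δ * θ) ≠ 0) with hIm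
  have hcore := pp_core (G := L ≃ₐ[Ft] L) DB δ hDBg hDBcomm p q hq hqp M hp2 c (fam A0) (fam B') haux T hT hgood
    (T.card * e * (A0 + γ' + q * (B' + γ')))
    (fun N hN => pp_degbound hOK hcompat W.valuation hW1 hW2 (fam A0) (fam B') _ _ q
      (hVfam A0) (hVfam B') c T N hN) Im
    (fun a ha h => by
      rw [hIm, Finset.mem_filter] at ha
      apply ha.2.2
      rw [map_mul, h, zero_mul])
    (fun a ha Q hQ hQ2 σ hσ => by
      rw [hIm, Finset.mem_filter] at ha
      apply hT2
      refine pp_frob_fix lc F e0 Z hZ θ hθ p q hfr a (fun h => ha.2.2 ?_) ha.2.1 Q hQ hQ2 σ hσ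
      rw [map_mul, h, mul_zero])
  have hIcard : I.ncard ≤ Im.card + (δ * θ).natDegree := by
    calc I.ncard ≤ ((Im : Set (O ⧸ p)) ∪ {a : O ⧸ p | ppev p a (δ * θ) = 0}).ncard := by
          refine Set.ncard_le_ncard (fun a ha => ?_) (Set.toFinite _)
          by_cases h : ppev p a (δ * θ) = 0
          · exact Or.inr h
          · exact Or.inl (Finset.mem_coe.mpr (Finset.mem_filter.mpr ⟨Finset.mem_univ _, ha, h⟩))
      _ ≤ _ := (Set.ncard_union_le _ _).trans
        (add_le_add (Set.ncard_coe_finset _).le (pp_zeros p _ hp4))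
  have hfinal : e * Im.card ≤ T.card * (A0 + γ') + 3 * T.card * q := by
    have h1 : (e * (γ' + 1)) * (e * Im.card) ≤
        (e * (γ' + 1)) * (T.card * (A0 + γ') + 3 * T.card * q) := by
      calc _ = M * e * Im.card := by rw [hM]; ring
        _ ≤ _ := hcore
        _ ≤ _ := by
          have h2 : B' + γ' ≤ 3 * (γ' + 1) := by omega
          have h3 : A0 + γ' ≤ (A0 + γ') * (γ' + 1) := Nat.le_mul_of_pos_right _ (by omega)
          calc T.card * e * (A0 + γ' + q * (B' + γ')) ≤
              T.card * e * ((A0 + γ') * (γ' + 1) + q * (3 * (γ' + 1))) :=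
                Nat.mul_le_mul_left _ (add_le_add h3 (Nat.mul_le_mul_left _ h2))
            _ = _ := by ring
    exact Nat.le_of_mul_le_mul_left h1 (by positivity)
  calc e * I.ncard ≤ e * (Im.card + (δ * θ).natDegree) := Nat.mul_le_mul_left _ hIcard
    _ ≤ _ := by rw [mul_add]; omega

end p9b

end part9

section part10

section p10a
universe u
variable {O K Ft L : Type u} [Field K] [Field Ft] [Field L] [CharZero K] [Algebra K[X] Ft]
  [IsFractionRing K[X] Ft] [Algebra Ft L] [Algebra K[X] L] [IsScalarTower K[X] Ft L] [Algebra K L]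
  [IsScalarTower K K[X] L] [FiniteDimensional Ft L] [IsGalois Ft L]
  [CommRing O] [IsDomain O] [Algebra O K] [IsFractionRing O K] [Algebra O[X] Ft]
  [IsFractionRing O[X] Ft] [Algebra O[X] L] [IsScalarTower O[X] Ft L] [CharZero O]
  [IsNoetherianRing O] [IsIntegrallyClosed O]

theorem pp_lead (F : O[X]) (hF : 1 ≤ F.natDegree) :
    (F.map C - C X : O[X][X]).leadingCoeff = C F.leadingCoeff := by
  have h1 : (F.map C : O[X][X]).natDegree = F.natDegree := natDegree_map_eq_of_injective C_injective _
  have h2 : (F.map C - C X : O[X][X]).natDegree = F.natDegree := by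
    rw [natDegree_sub_C, h1]
  rw [leadingCoeff, h2, coeff_sub, coeff_map, coeff_C, if_neg (by omega), sub_zero]; rfl

theorem pp_gen (hcompat : ∀ g : O[X], algebraMap O[X] L g = algebraMap K[X] L (g.map (algebraMap O K)))
    (halg : ∀ x : L, IsAlgebraic K x → x ∈ Set.range (algebraMap K L))
    (F : O[X]) (hF : 1 ≤ F.natDegree)
    (hsplit : ((F.map C - C X : O[X][X]).map (algebraMap O[X] L)).Splits)
    (T : Finset (L ≃ₐ[Ft] L))
    (hT : ∀ σ, σ ∈ T ↔ ∃ x : L, aeval x (F.map C - C X : O[X][X]) = 0 ∧ σ x = x) :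
    ∃ g0 : O, g0 ≠ 0 ∧ ∃ Cst : ℕ, ∀ p : Ideal O, p.IsMaximal → Finite (O ⧸ p) → g0 ∉ p →
      Nat.card (L ≃ₐ[Ft] L) *
        (Set.range (fun c : O ⧸ p => (F.map (Ideal.Quotient.mk p)).eval c)).ncard ≤
      3 * T.card * Nat.card (O ⧸ p) + Cst := by
  classical
  set P : O[X][X] := F.map C - C X with hP
  have hlead : P.leadingCoeff = C F.leadingCoeff := pp_lead F hF
  have hinjO : Function.Injective (algebraMap O[X] L) := pp_injO O Ft L
  have : FaithfulSMul O[X] L := (faithfulSMul_iff_algebraMap_injective _ _).mpr hinjO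
  let B := integralClosure O[X] L
  have : Module.Finite O[X] B := IsIntegralClosure.finite O[X] Ft L B
  have : IsFractionRing B L := IsIntegralClosure.isFractionRing_of_finite_extension O[X] Ft L B
  letI := IsIntegralClosure.MulSemiringAction O[X] Ft L B
  have : Algebra.IsInvariant O[X] B (L ≃ₐ[Ft] L) := Algebra.isInvariant_of_isGalois O[X] Ft L B
  have : SMulCommClass (L ≃ₐ[Ft] L) O[X] B := ⟨fun σ r x => map_smul (galRestrict O[X] Ft L B σ) r x⟩
  have : FaithfulSMul O[X] B := inferInstance
  have hsm : ∀ (σ : L ≃ₐ[Ft] L) (x : B), algebraMap B L (σ • x) = σ (algebraMap B L x) :=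
    fun σ x => algebraMap_galRestrict_apply O[X] σ x
  have hlc0 : F.leadingCoeff ≠ 0 := by
    rw [Ne, leadingCoeff_eq_zero]; rintro rfl; simp at hF
  have hlcL : algebraMap O[X] L (C F.leadingCoeff) ≠ 0 := by
    rw [Ne, map_eq_zero_iff _ hinjO, C_eq_zero]; exact hlc0
  have hPLlead : (P.map (algebraMap O[X] L)).leadingCoeff = algebraMap O[X] L (C F.leadingCoeff) := by
    rw [leadingCoeff_map_of_injective hinjO, hlead]
  have hPL0 : P.map (algebraMap O[X] L) ≠ 0 := by
    rw [Ne, ← leadingCoeff_eq_zero, hPLlead]; exact hlcL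
  have hPdeg : P.natDegree = F.natDegree := by
    rw [hP, natDegree_sub_C, natDegree_map_eq_of_injective C_injective]
  set R := (P.map (algebraMap O[X] L)).roots with hR
  have hRcard : R.card = F.natDegree := by
    rw [hR, ← hsplit.natDegree_eq_card_roots, natDegree_map_eq_of_injective hinjO, hPdeg]
  have hroot : ∀ x ∈ R, aeval x P = 0 := fun x hx => by
    have := (mem_roots hPL0).1 hx
    rwa [IsRoot, eval_map_algebraMap] at this
  have hIntegral : ∀ x ∈ R, algebraMap O[X] L (C F.leadingCoeff) * x ∈ B := fun x hx => by
    have := isIntegral_leadingCoeff_smul P x (hroot x hx)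
    rwa [hlead, Algebra.smul_def] at this
  set Z : Multiset B := R.pmap (fun x hx => (⟨algebraMap O[X] L (C F.leadingCoeff) * x, hx⟩ : B)) hIntegral
    with hZdef
  have hZmem : ∀ z ∈ Z, ∃ x ∈ R, algebraMap B L z = algebraMap O[X] L (C F.leadingCoeff) * x := by
    intro z hz
    rw [hZdef, Multiset.mem_pmap] at hz
    obtain ⟨x, hx, rfl⟩ := hz
    exact ⟨x, hx, rfl⟩
  have hTfix : ∀ (τ : L ≃ₐ[Ft] L) (x : L), aeval x P = 0 → aeval (τ x) P = 0 := fun τ x hx => by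
    have := aeval_algHom_apply ((τ : L →ₐ[Ft] L).restrictScalars O[X]) x P
    rw [hx, map_zero] at this
    exact this
  have hfixO : ∀ (τ : L ≃ₐ[Ft] L) (g : O[X]), τ (algebraMap O[X] L g) = algebraMap O[X] L g :=
    fun τ g => by rw [IsScalarTower.algebraMap_apply O[X] Ft L]; exact τ.commutes _
  have hBX : ∀ g : O[X], algebraMap B L (algebraMap O[X] B g) = algebraMap O[X] L g := fun g =>
    (IsScalarTower.algebraMap_apply O[X] B L g).symm
  refine pp_main B hsm hcompat halg F.leadingCoeff F (F.natDegree - 1) Z ?_ T ?_ ?_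
  · intro u
    apply IsIntegralClosure.algebraMap_injective B O[X] L
    have h1 : (P.map (algebraMap O[X] L)).eval (algebraMap O[X] L (C u)) =
        algebraMap O[X] L (C (F.eval u) - X) := by
      rw [eval_map, eval₂_at_apply, hP]
      congr 1
      simp [eval_map, eval₂_at_apply]
    rw [hsplit.eval_eq_prod_roots, hPLlead, ← hR] at h1
    rw [map_multiset_prod, Multiset.map_map, hZdef, Multiset.map_pmap]
    have h2 : (R.pmap (fun x hx => (⇑(algebraMap B L) ∘ fun z => ppc B (F.leadingCoeff * u) - z)
        (⟨algebraMap O[X] L (C F.leadingCoeff) * x, hx⟩ : B)) hIntegral) =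
        R.map (fun x => algebraMap O[X] L (C F.leadingCoeff) * (algebraMap O[X] L (C u) - x)) := by
      rw [← Multiset.pmap_eq_map (p := fun x => algebraMap O[X] L (C F.leadingCoeff) * x ∈ B) _ _ hIntegral]
      refine Multiset.pmap_congr _ fun x _ hx _ => ?_
      simp only [Function.comp_apply, map_sub, ppc, RingHom.comp_apply, hBX]
      rw [mul_sub, ← map_mul, ← C_mul]; rfl
    rw [h2, Multiset.prod_map_mul, Multiset.map_const', Multiset.prod_replicate, hRcard]
    obtain ⟨m, hm⟩ : ∃ m, F.natDegree = m + 1 := ⟨F.natDegree - 1, by omega⟩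
    simp only [map_mul, map_sub, ppc, RingHom.comp_apply, hBX, map_pow]
    rw [← map_sub, ← h1, hm, Nat.add_sub_cancel]
    ring
  · intro σ hσ τ
    rw [hT] at hσ ⊢
    obtain ⟨x, hx, hσx⟩ := hσ
    refine ⟨τ⁻¹ x, hTfix _ _ hx, ?_⟩
    have : τ (τ⁻¹ x) = x := by rw [← AlgEquiv.mul_apply, mul_inv_cancel]; rfl
    rw [AlgEquiv.mul_apply, AlgEquiv.mul_apply, this, hσx]
  · rintro σ ⟨z, hz, hσ⟩
    obtain ⟨x, hx, hzx⟩ := hZmem z hz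
    rw [hT]
    refine ⟨x, hroot x hx, ?_⟩
    have := hsm σ z
    rw [hσ, hzx, map_mul, hfixO] at this
    exact (mul_left_cancel₀ hlcL this).symm

end p10a

end part10

section p11a
attribute [local instance] Polynomial.algebra

theorem pp_frac (K : Type*) [Field K] [NumberField K] : IsFractionRing (𝓞 K)[X] (RatFunc K) := by
  have hmap : ∀ g : (𝓞 K)[X], algebraMap (𝓞 K)[X] (RatFunc K) g =
      algebraMap K[X] (RatFunc K) (g.map (algebraMap (𝓞 K) K)) := fun g => rfl
  have hinj : Function.Injective (algebraMap (𝓞 K)[X] (RatFunc K)) := by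
    intro a b hab
    rw [hmap, hmap] at hab
    exact map_injective _ (IsFractionRing.injective (𝓞 K) K)
      (IsFractionRing.injective K[X] (RatFunc K) hab)
  have : FaithfulSMul (𝓞 K)[X] (RatFunc K) := (faithfulSMul_iff_algebraMap_injective _ _).mpr hinj
  have key : ∀ p : K[X], ∃ x y : (𝓞 K)[X], y ≠ 0 ∧ algebraMap K[X] (RatFunc K) p =
      algebraMap (𝓞 K)[X] (RatFunc K) x / algebraMap (𝓞 K)[X] (RatFunc K) y := by
    intro p
    obtain ⟨b, hb, hbp⟩ := IsLocalization.integerNormalization_spec (nonZeroDivisors (𝓞 K)) p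
    have hb0 : (C b : (𝓞 K)[X]) ≠ 0 := by
      rw [Ne, C_eq_zero]; exact nonZeroDivisors.ne_zero hb
    refine ⟨IsLocalization.integerNormalization (nonZeroDivisors (𝓞 K)) p, C b, hb0, ?_⟩
    rw [eq_div_iff (by rwa [Ne, map_eq_zero_iff _ hinj]), hmap, hmap, ← map_mul, hbp, map_C,
      algebra_compatible_smul K, smul_eq_C_mul, mul_comm]
  refine IsFractionRing.of_field _ _ fun z => ?_
  obtain ⟨a, b, hb, rfl⟩ := IsFractionRing.div_surjective (A := K[X]) z
  obtain ⟨x, y, hy, hxy⟩ := key a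
  obtain ⟨x', y', hy', hxy'⟩ := key b
  refine ⟨x * y', y * x', ?_⟩
  rw [hxy, hxy', map_mul, map_mul, div_div_div_eq]

theorem pp_concrete {K : Type*} [Field K] [NumberField K] (f : (𝓞 K)[X]) (hd : 1 ≤ f.natDegree)
    (n : ℕ)
    (halg : ∀ x : (iterMinusT K f n).SplittingField,
        (∃ g : Polynomial K, g ≠ 0 ∧
          Polynomial.eval₂ (constEmb K (iterMinusT K f n)) x g = 0) →
        x ∈ Set.range (constEmb K (iterMinusT K f n))) :
    ∃ g0 : 𝓞 K, g0 ≠ 0 ∧ ∃ Cst : ℕ, ∀ p : Ideal (𝓞 K), p.IsMaximal → Finite (𝓞 K ⧸ p) → g0 ∉ p →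
      ((Set.range (fun c : 𝓞 K ⧸ p => ((((fun g => f.comp g)^[n] X)).map
        (Ideal.Quotient.mk p)).eval c)).ncard : ℝ) ≤
      3 * FPP (iterMinusT K f n) * Nat.card (𝓞 K ⧸ p) + Cst := by
  classical
  set h := iterMinusT K f n with hh
  set F : (𝓞 K)[X] := (fun g => f.comp g)^[n] X with hFdef
  have hF : 1 ≤ F.natDegree := by
    have := natDegree_iterate_comp (p := f) (q := X) n
    rw [hFdef]
    change 1 ≤ (f.comp^[n] X).natDegree
    rw [this, natDegree_X, mul_one]
    exact Nat.one_le_pow _ _ hd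
  have := pp_frac K
  have : IsScalarTower K K[X] h.SplittingField := IsScalarTower.of_algebraMap_eq fun c => rfl
  have : IsGalois (RatFunc K) h.SplittingField := { }
  have hmapP : (F.map C - C X : (𝓞 K)[X][X]).map (algebraMap (𝓞 K)[X] (RatFunc K)) = h := by
    rw [hh, iterMinusT, Polynomial.map_sub, map_map, map_C]
    congr 2
    · refine RingHom.ext fun c => ?_
      change algebraMap K[X] (RatFunc K) ((C c).map (algebraMap (𝓞 K) K)) = _
      rw [map_C]; rfl
    · change algebraMap K[X] (RatFunc K) (X.map (algebraMap (𝓞 K) K)) = _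
      rw [map_X, RatFunc.algebraMap_X]
  have haev : ∀ x : h.SplittingField, aeval x (F.map C - C X : (𝓞 K)[X][X]) = aeval x h := by
    intro x
    exact (aeval_map_algebraMap (RatFunc K) x _).symm.trans (congrArg (fun q => aeval x q) hmapP)
  let T : Finset (h.SplittingField ≃ₐ[RatFunc K] h.SplittingField) :=
    (Set.toFinite {σ : h.SplittingField ≃ₐ[RatFunc K] h.SplittingField |
      ∃ x : h.SplittingField, aeval x h = 0 ∧ σ x = x}).toFinset
  obtain ⟨g0, hg0, Cst, hC⟩ := pp_gen (O := 𝓞 K) (K := K) (Ft := RatFunc K) (L := h.SplittingField)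
    (fun g => rfl)
    (fun x ⟨g, hg, hgx⟩ => halg x ⟨g, hg, hgx⟩) F hF
    (by
      have h1 : (F.map C - C X : (𝓞 K)[X][X]).map (algebraMap (𝓞 K)[X] h.SplittingField) =
          h.map (algebraMap (RatFunc K) h.SplittingField) := by
        refine Eq.trans ?_ (congrArg (fun q => q.map (algebraMap (RatFunc K) h.SplittingField)) hmapP)
        simp only [map_map]; rfl
      rw [h1]
      exact SplittingField.splits h) T
    (fun σ => by
      simp only [T, Set.Finite.mem_toFinset, Set.mem_setOf_eq, haev])
  refine ⟨g0, hg0, Cst, fun p hp hfin hgp => ?_⟩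
  have h1 := hC p hp hfin hgp
  have hFPP : FPP h = (T.card : ℝ) / Nat.card (h.SplittingField ≃ₐ[RatFunc K] h.SplittingField) := by
    rw [FPP]
    congr 2
    rw [← Set.ncard_coe_finset]
    simp only [T, Set.Finite.coe_toFinset]
    rfl
  set e := Nat.card (h.SplittingField ≃ₐ[RatFunc K] h.SplittingField) with he
  have hepos : 0 < e := Nat.card_pos
  have hepos' : (1 : ℝ) ≤ e := by exact_mod_cast hepos
  rw [hFPP]
  have h2 : (e : ℝ) * ((Set.range (fun c : 𝓞 K ⧸ p => (F.map
        (Ideal.Quotient.mk p)).eval c)).ncard : ℝ) ≤ 3 * T.card * Nat.card (𝓞 K ⧸ p) + Cst := by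
    exact_mod_cast h1
  have h3 : (0 : ℝ) ≤ Cst := Nat.cast_nonneg _
  have h4 : (e : ℝ) * (3 * ((T.card : ℝ) / e) * Nat.card (𝓞 K ⧸ p) + Cst) =
      3 * T.card * Nat.card (𝓞 K ⧸ p) + e * Cst := by
    field_simp
  have h5 : (Cst : ℝ) ≤ e * Cst := le_mul_of_one_le_left h3 hepos'
  exact le_of_mul_le_mul_left (by rw [h4]; linarith) (by linarith : (0 : ℝ) < e)

end p11a

theorem pp_iter_eval {R : Type*} [CommRing R] (f : R[X]) (I : Ideal R) (n : ℕ) (c : R ⧸ I) :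
    (((fun g => f.comp g)^[n] X).map (Ideal.Quotient.mk I)).eval c =
      (fun w => (f.map (Ideal.Quotient.mk I)).eval w)^[n] c := by
  induction n with
  | zero => simp
  | succ n ih =>
    rw [Function.iterate_succ_apply', Function.iterate_succ_apply', map_comp, eval_comp, ih]

theorem pp_per_le {R : Type*} [CommRing R] (f : R[X]) (I : Ideal R) [Finite (R ⧸ I)] (n : ℕ) :
    perCount f I ≤ (Set.range (fun c : R ⧸ I => (((fun g => f.comp g)^[n] X).map
      (Ideal.Quotient.mk I)).eval c)).ncard := by
  refine Set.ncard_le_ncard ?_ (Set.toFinite _)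
  rintro z ⟨m, hm, hz⟩
  set φ := fun w => (f.map (Ideal.Quotient.mk I)).eval w with hφ
  have h1 : φ^[n * m] z = z := by
    rw [mul_comm, Function.iterate_mul]
    exact Function.iterate_fixed hz n
  refine ⟨φ^[n * m - n] z, ?_⟩
  simp only [pp_iter_eval]
  rw [← hφ, ← Function.iterate_add_apply, Nat.add_sub_cancel' (Nat.le_mul_of_pos_right n hm), h1]

/-- Let `f ∈ 𝓞_K[x]` of degree `d ≥ 2`, and for `n ≥ 1` let `G_n` be
the Galois group of `f^{∘n}(x) − t` over `K(t)`.  If `K` is algebraically closed in each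
`K_n` and `FPP(G_n) → 0`, then the proportion of periodic points of `f_𝔭` on the
projective line over `κ(𝔭)` tends to `0`: for every `ε > 0` there is `M` such that all
primes `𝔭` with `N(𝔭) > M` avoiding the leading coefficient of `f` satisfy
`#Per(f_𝔭) + 1 ≤ ε·(N(𝔭) + 1)`. -/
theorem per_proportion_tendsto_zero {K : Type*} [Field K] [NumberField K]
    (f : Polynomial (𝓞 K)) (d : ℕ) (hd : 2 ≤ d) (hdeg : f.natDegree = d)
    (halg : ∀ n : ℕ, 1 ≤ n →
      ∀ x : (iterMinusT K f n).SplittingField,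
        (∃ g : Polynomial K, g ≠ 0 ∧
          Polynomial.eval₂ (constEmb K (iterMinusT K f n)) x g = 0) →
        x ∈ Set.range (constEmb K (iterMinusT K f n)))
    (hFPP : Filter.Tendsto (fun n => FPP (iterMinusT K f n)) Filter.atTop (nhds 0)) :
    ∀ ε : ℝ, 0 < ε → ∃ M : ℝ,
      ∀ 𝔭 : Ideal (𝓞 K), 𝔭.IsPrime → 𝔭 ≠ ⊥ → M < (Ideal.absNorm 𝔭 : ℝ) →
        f.leadingCoeff ∉ 𝔭 →
        (perCount f 𝔭 : ℝ) + 1 ≤ ε * ((Ideal.absNorm 𝔭 : ℝ) + 1) := by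
  intro ε hε
  have hev : ∀ᶠ n in Filter.atTop, FPP (iterMinusT K f n) < ε / 6 :=
    hFPP.eventually (gt_mem_nhds (by linarith))
  obtain ⟨n, hn1, hn⟩ := (hev.and (Filter.eventually_ge_atTop 1)).exists
  obtain ⟨g0, hg0, Cst, hC⟩ := pp_concrete f (by omega) n (halg n hn)
  refine ⟨max ((Ideal.absNorm (Ideal.span {g0}) : ℕ) : ℝ) (2 * (Cst + 1) / ε), ?_⟩
  intro 𝔭 hp hp0 hM _
  have hmax : 𝔭.IsMaximal := hp.isMaximal hp0
  have hfin : Finite (𝓞 K ⧸ 𝔭) := Ideal.finiteQuotientOfFreeOfNeBot 𝔭 hp0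
  have hgp : g0 ∉ 𝔭 := by
    intro hmem
    have h1 : Ideal.absNorm 𝔭 ∣ Ideal.absNorm (Ideal.span {g0}) :=
      Ideal.absNorm_dvd_absNorm_of_le ((Ideal.span_singleton_le_iff_mem _).mpr hmem)
    have h2 : Ideal.absNorm (Ideal.span {g0}) ≠ 0 := by
      rw [Ne, Ideal.absNorm_eq_zero_iff, Ideal.span_singleton_eq_bot]; exact hg0
    have h3 : ((Ideal.absNorm 𝔭 : ℕ) : ℝ) ≤ (Ideal.absNorm (Ideal.span {g0}) : ℕ) := by
      exact_mod_cast Nat.le_of_dvd (Nat.pos_of_ne_zero h2) h1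
    exact absurd ((le_max_left _ _).trans_lt hM) (not_lt.mpr h3)
  have h1 := hC 𝔭 hmax hfin hgp
  have h2 : (perCount f 𝔭 : ℝ) ≤ _ := Nat.cast_le.mpr (pp_per_le f 𝔭 n)
  have hN : Nat.card (𝓞 K ⧸ 𝔭) = Ideal.absNorm 𝔭 := rfl
  rw [hN] at h1
  have h3 : 2 * ((Cst : ℝ) + 1) / ε < Ideal.absNorm 𝔭 := (le_max_right _ _).trans_lt hM
  rw [div_lt_iff₀ hε] at h3
  have h4 : 3 * FPP (iterMinusT K f n) * (Ideal.absNorm 𝔭 : ℝ) ≤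
      ε / 2 * (Ideal.absNorm 𝔭 : ℝ) :=
    mul_le_mul_of_nonneg_right (by linarith) (Nat.cast_nonneg _)
  linarith
end

section
/- Let K ⊆ K′ be number fields with rings of integers 𝓞_K ⊆ 𝓞_{K′}, let f ∈ 𝓞_K[x] be nonconstant with image f′ ∈ 𝓞_{K′}[x], and let L ≥ 0 be a real number. Suppose that for every ε > 0, all but finitely many nonzero prime ideals 𝔮 of 𝓞_{K′} with the leading coefficient of f′ not in 𝔮 satisfy #Per(f′_𝔮) ≤ (L + ε)·(N(𝔮) + 1). Then for every ε > 0 there are infinitely many nonzero prime ideals 𝔭 of 𝓞_K with the leading coefficient of f not in 𝔭 such that #Per(f_𝔭) ≤ (L + ε)·(N(𝔭) + 1). (This expresses that the liminf of #Per(f_𝔭)/(N(𝔭)+1) over primes of K is at most the limsup of #Per(f′_𝔮)/(N(𝔮)+1) over primes of K′.) -/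
open NumberField

open Polynomial in
/-- Schur: values of a nonconstant integer polynomial have arbitrarily large prime divisors. -/
lemma schur_aux (g : Polynomial ℤ) (hg : 0 < g.natDegree) (N : ℕ) :
    ∃ p : ℕ, p.Prime ∧ N < p ∧ ∃ a : ℤ, (p : ℤ) ∣ g.eval a := by
  by_cases hc : g.eval 0 = 0
  · obtain ⟨p, hp, hpp⟩ := Nat.exists_infinite_primes (N + 1)
    exact ⟨p, hpp, hp, 0, by rw [hc]; exact dvd_zero _⟩
  · set c := g.eval 0 with hcdef
    have hfin : ∀ b : ℤ, {x : ℤ | g.eval x = b}.Finite := by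
      intro b
      have hne : g - C b ≠ 0 := by
        intro h
        rw [sub_eq_zero] at h
        rw [h, natDegree_C] at hg
        exact lt_irrefl _ hg
      refine ((g - C b).roots.toFinset.finite_toSet).subset ?_
      intro x hx
      have hx' : g.eval x = b := hx
      rw [Finset.mem_coe, Multiset.mem_toFinset, mem_roots hne, IsRoot.def, eval_sub, eval_C, hx',
        sub_self]
    have hinj : Function.Injective (fun t : ℤ => c * (N.factorial : ℤ) * t) := by
      intro s t h
      exact mul_left_cancel₀ (mul_ne_zero hc (by exact_mod_cast N.factorial_ne_zero)) h
    have hF : ((fun t : ℤ => c * (N.factorial : ℤ) * t) ⁻¹'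
        ({x : ℤ | g.eval x = c} ∪ {x : ℤ | g.eval x = -c})).Finite :=
      Set.Finite.preimage hinj.injOn ((hfin c).union (hfin (-c)))
    obtain ⟨t, ht⟩ := hF.exists_notMem
    obtain ⟨k, hk⟩ := g.sub_dvd_eval_sub (c * (N.factorial : ℤ) * t) 0
    have hval : g.eval (c * (N.factorial : ℤ) * t) = c * (1 + N.factorial * (t * k)) := by
      linear_combination hk
    have hu : (1 + (N.factorial : ℤ) * (t * k)).natAbs ≠ 1 := by
      intro h
      apply ht
      rcases Int.natAbs_eq (1 + (N.factorial : ℤ) * (t * k)) with h1 | h1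
      · left
        rw [h] at h1
        show g.eval _ = c
        rw [hval, h1]; simp
      · right
        rw [h] at h1
        show g.eval _ = -c
        rw [hval, h1]; simp
    obtain ⟨p, hp, hpd⟩ := Nat.exists_prime_and_dvd hu
    have hpd' : (p : ℤ) ∣ 1 + (N.factorial : ℤ) * (t * k) := Int.natCast_dvd.mpr hpd
    refine ⟨p, hp, ?_, c * (N.factorial : ℤ) * t, by rw [hval]; exact hpd'.mul_left _⟩
    by_contra hle
    push Not at hle
    have h1 : (p : ℤ) ∣ (N.factorial : ℤ) := by
      exact_mod_cast (hp.dvd_factorial).mpr hle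
    have h2 : (p : ℤ) ∣ 1 := (dvd_add_left (h1.mul_right _)).mp hpd'
    exact hp.one_lt.ne' (by exact_mod_cast Int.eq_one_of_dvd_one (by positivity) h2)

/-- A number field has an integral element of nonzero exponent. -/
lemma exists_exponent_ne_zero (F : Type*) [Field F] [NumberField F] :
    ∃ θ : 𝓞 F, RingOfIntegers.exponent θ ≠ 0 := by
  obtain ⟨α, hα⟩ := Field.exists_primitive_element ℚ F
  have hint : IsIntegral ℚ α := Algebra.IsIntegral.isIntegral α
  have htop : Algebra.adjoin ℚ {α} = ⊤ := by
    rw [← IntermediateField.adjoin_simple_toSubalgebra_of_isAlgebraic hint.isAlgebraic, hα,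
      IntermediateField.top_toSubalgebra]
  have halg : IsAlgebraic ℤ α :=
    (IsFractionRing.isAlgebraic_iff ℤ ℚ F).mpr hint.isAlgebraic
  obtain ⟨d, hd, hdα⟩ := halg.exists_integral_multiple
  let θ : 𝓞 F := ⟨d • α, hdα⟩
  have key : ∀ x : F, ∃ e : ℤ, e ≠ 0 ∧ ∃ y ∈ Algebra.adjoin ℤ {θ}, (e : F) * x = algebraMap (𝓞 F) F y := by
    intro x
    have hx : x ∈ Algebra.adjoin ℚ {α} := by rw [htop]; trivial
    induction hx using Algebra.adjoin_induction with
    | mem x hx =>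
      rw [Set.mem_singleton_iff] at hx
      subst hx
      refine ⟨d, hd, θ, Algebra.subset_adjoin rfl, ?_⟩
      show _ = d • x
      simp
    | algebraMap r =>
      refine ⟨r.den, by exact_mod_cast r.den_ne_zero, (r.num : 𝓞 F), ?_, ?_⟩
      · exact Subalgebra.intCast_mem _ _
      · have h := congrArg (algebraMap ℚ F) (Rat.den_mul_eq_num r)
        rw [map_mul, map_natCast, map_intCast] at h
        rw [map_intCast, Int.cast_natCast]
        exact h
    | add x y _ _ hx hy =>
      obtain ⟨a, ha, u, hu, hau⟩ := hx
      obtain ⟨b, hb, v, hv, hbv⟩ := hy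
      refine ⟨a * b, mul_ne_zero ha hb, (b : 𝓞 F) * u + (a : 𝓞 F) * v, ?_, ?_⟩
      · exact add_mem (mul_mem (Subalgebra.intCast_mem _ _) hu)
          (mul_mem (Subalgebra.intCast_mem _ _) hv)
      · rw [map_add, map_mul, map_mul, map_intCast, map_intCast, ← hau, ← hbv]
        push_cast
        ring
    | mul x y _ _ hx hy =>
      obtain ⟨a, ha, u, hu, hau⟩ := hx
      obtain ⟨b, hb, v, hv, hbv⟩ := hy
      refine ⟨a * b, mul_ne_zero ha hb, u * v, mul_mem hu hv, ?_⟩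
      rw [map_mul, ← hau, ← hbv]
      push_cast
      ring
  have key' : ∀ x : 𝓞 F, ∃ e : ℤ, e ≠ 0 ∧ (e : 𝓞 F) * x ∈ Algebra.adjoin ℤ {θ} := by
    intro x
    obtain ⟨e, he, y, hy, hxy⟩ := key x
    refine ⟨e, he, ?_⟩
    have : (e : 𝓞 F) * x = y := by
      apply RingOfIntegers.ext
      simpa using hxy
    rwa [this]
  choose e he hmem using key'
  obtain ⟨S, hS⟩ := (Module.Finite.fg_top : (⊤ : Submodule ℤ (𝓞 F)).FG)
  refine ⟨θ, ?_⟩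
  have hcond : ((∏ s ∈ S, e s : ℤ) : 𝓞 F) ∈ conductor ℤ θ := by
    rw [mem_conductor_iff]
    intro b
    have hb : b ∈ Submodule.span ℤ (S : Set (𝓞 F)) := by rw [hS]; trivial
    induction hb using Submodule.span_induction with
    | mem s hs =>
      obtain ⟨k, hk⟩ := Finset.dvd_prod_of_mem e (Finset.mem_coe.mp hs)
      have : ((∏ s ∈ S, e s : ℤ) : 𝓞 F) * s = (k : 𝓞 F) * ((e s : 𝓞 F) * s) := by
        rw [hk]; push_cast; ring
      rw [this]
      exact mul_mem (Subalgebra.intCast_mem _ _) (hmem s)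
    | zero => rw [mul_zero]; exact zero_mem _
    | add x y _ _ hx hy => rw [mul_add]; exact add_mem hx hy
    | smul a x _ hx =>
      rw [mul_smul_comm]
      exact Subalgebra.smul_mem _ hx a
  rw [RingOfIntegers.exponent, Ne, Ideal.absNorm_eq_zero_iff]
  intro h0
  have : (∏ s ∈ S, e s : ℤ) ∈ Ideal.under ℤ (conductor ℤ θ) := by
    rw [Ideal.under_def, Ideal.mem_comap]
    simpa using hcond
  rw [h0, Ideal.mem_bot] at this
  exact Finset.prod_ne_zero_iff.mpr (fun s _ => he s) this

open Polynomial in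
/-- Arbitrarily large primes `p` with a ring homomorphism `𝓞 F → ZMod p`. -/
lemma exists_hom_zmod (F : Type*) [Field F] [NumberField F] (N : ℕ) :
    ∃ p : ℕ, p.Prime ∧ N < p ∧ Nonempty (𝓞 F →+* ZMod p) := by
  obtain ⟨θ, hθ⟩ := exists_exponent_ne_zero F
  have hθi : IsIntegral ℤ θ := Algebra.IsIntegral.isIntegral θ
  obtain ⟨p, hp, hlt, a, ha⟩ := schur_aux (minpoly ℤ θ) (minpoly.natDegree_pos hθi)
    (max N (RingOfIntegers.exponent θ))
  have : Fact p.Prime := ⟨hp⟩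
  have hnd : ¬ p ∣ RingOfIntegers.exponent θ := fun h =>
    absurd (Nat.le_of_dvd (Nat.pos_of_ne_zero hθ) h) (by
      have := lt_of_le_of_lt (le_max_right _ _) hlt
      omega)
  refine ⟨p, hp, lt_of_le_of_lt (le_max_left _ _) hlt, ⟨?_⟩⟩
  refine RingHom.comp ?_ ((RingOfIntegers.ZModXQuotSpanEquivQuotSpan hnd).symm.toRingHom.comp
    (Ideal.Quotient.mk _))
  refine Ideal.Quotient.lift _ (evalRingHom ((a : ℤ) : ZMod p)) ?_
  intro x hx
  obtain ⟨y, rfl⟩ := Ideal.mem_span_singleton.mp hx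
  have h0 : (((minpoly ℤ θ).eval a : ℤ) : ZMod p) = 0 :=
    (ZMod.intCast_zmod_eq_zero_iff_dvd _ _).mpr ha
  have h1 : ((minpoly ℤ θ).map (Int.castRingHom (ZMod p))).eval ((a : ℤ) : ZMod p) = 0 := by
    rw [← h0, eval_intCast_map]
    simp
  simp [h1]

/-- The periodic count transported along a surjection. -/
lemma perCount_ker {R A : Type*} [CommRing R] [CommRing A] (f : Polynomial R) (φ : R →+* A)
    (hφ : Function.Surjective φ) :
    perCount f (RingHom.ker φ) =
      Set.ncard {z : A | ∃ m : ℕ, 0 < m ∧ (fun w => (f.map φ).eval w)^[m] z = z} := by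
  let e := RingHom.quotientKerEquivOfSurjective hφ
  have hsemi : Function.Semiconj e
      (fun w => (f.map (Ideal.Quotient.mk (RingHom.ker φ))).eval w)
      (fun w => (f.map φ).eval w) := by
    intro w
    have hcomp : (e : _ →+* A).comp (Ideal.Quotient.mk (RingHom.ker φ)) = φ := by
      ext x; rfl
    show e (Polynomial.eval w _) = _
    have := Polynomial.eval_map_apply (p := f.map (Ideal.Quotient.mk (RingHom.ker φ)))
      (e : _ →+* A) w
    rw [Polynomial.map_map, hcomp] at this
    exact this.symm
  rw [perCount, ← Set.ncard_image_of_injective _ e.injective]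
  congr 1
  ext z
  constructor
  · rintro ⟨w, ⟨m, hm, hw⟩, rfl⟩
    refine ⟨m, hm, ?_⟩
    rw [← (hsemi.iterate_right m) w, hw]
  · rintro ⟨m, hm, hz⟩
    obtain ⟨w, rfl⟩ := e.surjective z
    refine ⟨w, ⟨m, hm, e.injective ?_⟩, rfl⟩
    rw [(hsemi.iterate_right m) w, hz]

lemma absNorm_ker {F : Type*} [Field F] [NumberField F] {p : ℕ} [Fact p.Prime]
    (φ : 𝓞 F →+* ZMod p) : Ideal.absNorm (RingHom.ker φ) = p := by
  have hφ : Function.Surjective φ := ZMod.ringHom_surjective φ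
  rw [Ideal.absNorm_apply, Submodule.cardQuot_apply]
  exact (Nat.card_congr (RingHom.quotientKerEquivOfSurjective hφ).toEquiv).trans (Nat.card_zmod p)

/-- Let `K ⊆ K'` be number fields, `f ∈ 𝓞_K[x]` nonconstant with image
`f'` over `𝓞_{K'}`, and `L ≥ 0`.  If for every `ε > 0` all but finitely many nonzero
primes `𝔮` of `𝓞_{K'}` (away from the leading coefficient) satisfy
`#Per(f'_𝔮) ≤ (L + ε)(N(𝔮) + 1)`, then for every `ε > 0` infinitely many nonzero primes
`𝔭` of `𝓞_K` (away from the leading coefficient) satisfy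
`#Per(f_𝔭) ≤ (L + ε)(N(𝔭) + 1)`. -/
theorem liminf_le_limsup_of_extension {K K' : Type*} [Field K] [NumberField K]
    [Field K'] [NumberField K'] [Algebra K K']
    (f : Polynomial (𝓞 K)) (hf : 0 < f.natDegree) (L : ℝ) (hL : 0 ≤ L)
    (hyp : ∀ ε : ℝ, 0 < ε →
      {𝔮 : Ideal (𝓞 K') | 𝔮.IsPrime ∧ 𝔮 ≠ ⊥ ∧
        (f.map (algebraMap (𝓞 K) (𝓞 K'))).leadingCoeff ∉ 𝔮 ∧
        ¬((perCount (f.map (algebraMap (𝓞 K) (𝓞 K'))) 𝔮 : ℝ) ≤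
            (L + ε) * ((Ideal.absNorm 𝔮 : ℝ) + 1))}.Finite) :
    ∀ ε : ℝ, 0 < ε →
      {𝔭 : Ideal (𝓞 K) | 𝔭.IsPrime ∧ 𝔭 ≠ ⊥ ∧ f.leadingCoeff ∉ 𝔭 ∧
        (perCount f 𝔭 : ℝ) ≤ (L + ε) * ((Ideal.absNorm 𝔭 : ℝ) + 1)}.Infinite := by
  classical
  intro ε hε hfinP
  have hfinQ := hyp ε hε
  set f' := f.map (algebraMap (𝓞 K) (𝓞 K')) with hf'
  have hinj : Function.Injective (algebraMap (𝓞 K) (𝓞 K')) :=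
    FaithfulSMul.algebraMap_injective _ _
  have hlc : f'.leadingCoeff = algebraMap (𝓞 K) (𝓞 K') f.leadingCoeff :=
    Polynomial.leadingCoeff_map_of_injective hinj f
  have hlc0 : f'.leadingCoeff ≠ 0 := by
    rw [hlc]
    intro h
    have h0 := hinj (h.trans (map_zero _).symm)
    rw [Polynomial.leadingCoeff_eq_zero] at h0
    rw [h0] at hf
    simp at hf
  obtain ⟨B₁, hB₁⟩ := (hfinP.image Ideal.absNorm).bddAbove
  obtain ⟨B₂, hB₂⟩ := (hfinQ.image Ideal.absNorm).bddAbove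
  let B₃ := Ideal.absNorm (Ideal.span {f'.leadingCoeff})
  have hB₃ : B₃ ≠ 0 := by
    simp only [B₃, Ne, Ideal.absNorm_eq_zero_iff, Ideal.span_singleton_eq_bot]
    exact hlc0
  obtain ⟨p, hp, hlt, ⟨ψ⟩⟩ := exists_hom_zmod K' (B₁ + B₂ + B₃)
  have : Fact p.Prime := ⟨hp⟩
  let φ := ψ.comp (algebraMap (𝓞 K) (𝓞 K'))
  have hNq := absNorm_ker ψ
  have hNp := absNorm_ker φ
  have hmem : f'.leadingCoeff ∉ RingHom.ker ψ := by
    intro h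
    have h1 := Ideal.absNorm_dvd_absNorm_of_le ((Ideal.span_singleton_le_iff_mem _).mpr h)
    rw [hNq] at h1
    have := Nat.le_of_dvd (Nat.pos_of_ne_zero hB₃) h1
    omega
  have hmem' : f.leadingCoeff ∉ RingHom.ker φ := by
    intro h
    apply hmem
    rw [RingHom.mem_ker] at h ⊢
    rw [hlc]
    exact h
  have hqbot : RingHom.ker ψ ≠ ⊥ := by
    intro h
    rw [h, Ideal.absNorm_bot] at hNq
    exact hp.ne_zero hNq.symm
  have hpbot : RingHom.ker φ ≠ ⊥ := by
    intro h
    rw [h, Ideal.absNorm_bot] at hNp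
    exact hp.ne_zero hNp.symm
  have hcount : perCount f (RingHom.ker φ) = perCount f' (RingHom.ker ψ) := by
    rw [perCount_ker f φ (ZMod.ringHom_surjective φ),
      perCount_ker f' ψ (ZMod.ringHom_surjective ψ), hf', Polynomial.map_map]
  have hgood : (perCount f' (RingHom.ker ψ) : ℝ) ≤
      (L + ε) * ((Ideal.absNorm (RingHom.ker ψ) : ℝ) + 1) := by
    by_contra hbad
    have := hB₂ ⟨RingHom.ker ψ, ⟨RingHom.ker_isPrime ψ, hqbot, hmem, hbad⟩, rfl⟩
    rw [hNq] at this
    omega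
  have hgood' : (perCount f (RingHom.ker φ) : ℝ) ≤
      (L + ε) * ((Ideal.absNorm (RingHom.ker φ) : ℝ) + 1) := by
    rw [hcount, hNp]
    rw [hNq] at hgood
    exact hgood
  have := hB₁ ⟨RingHom.ker φ, ⟨RingHom.ker_isPrime φ, hpbot, hmem', hgood'⟩, rfl⟩
  rw [hNp] at this
  omega
end
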